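/- arXiv:2111.15223 — 2 statements merged into one kernel-verified Lean document; each statement's English description precedes it below -/
import Mathlib

section
/- Let q = e^{2πi/3}, let n ≥ 0, and let β be a nonzero complex number with β² ≠ 1; set x = −(βq − (βq)^{−1})/(β − β^{−1}) and assume 1 − x + x² ≠ 0. Then for every extension X of the symplectic character ratio of size 2n+1, one has X(1, …, 1, (β/q)²) = ( 3^{n²} / (1 − x + x²)^n ) · det_{i,j=1}^{n} ( (x−1)² C(i+j−2, 2j−i−1) + x · C(i+j, 2j−i) ), where the first 2n arguments of X equal 1 and the empty determinant (n = 0) equals 1. -/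
noncomputable section

/-- `δ_i = N − i + 1` for the 1-based index `i`; here `i : Fin N` is 0-based. -/
def deltaE (N : ℕ) (i : Fin N) : ℕ := N - i.1

/-- `μ_i = λ_i + δ_i` with `λ_i = ⌊(N−i)/2⌋` for the 1-based index `i`. -/
def muE (N : ℕ) (i : Fin N) : ℕ := (N - i.1 - 1) / 2 + (N - i.1)

/-- The determinant `det_{i,j} (z_j^{e_i} − z_j^{−e_i})`. -/
def sdet (N : ℕ) (e : Fin N → ℕ) (z : Fin N → ℂ) : ℂ :=
  Matrix.det (Matrix.of fun i j : Fin N => z j ^ (e i : ℤ) - z j ^ (-(e i : ℤ)))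

/-- `X` is a (continuous) extension of the symplectic character ratio of size `N`:
it agrees with `det(z_j^{μ_i} − z_j^{−μ_i}) / det(z_j^{δ_i} − z_j^{−δ_i})`
whenever the denominator is nonzero. -/
def IsSymplecticExt (N : ℕ) (X : (Fin N → ℂ) → ℂ) : Prop :=
  ContinuousOn X {z : Fin N → ℂ | ∀ i, z i ≠ 0} ∧
  ∀ z : Fin N → ℂ, (∀ i, z i ≠ 0) → sdet N (deltaE N) z ≠ 0 →
    X z = sdet N (muE N) z / sdet N (deltaE N) z

/-- Binomial coefficient `C(a,b)` for integers, vanishing unless `0 ≤ b ≤ a`. -/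
def zchoose (a b : ℤ) : ℤ := if 0 ≤ b ∧ b ≤ a then (a.toNat).choose b.toNat else 0

/-- The binomial coefficient with natural upper and integer lower index. -/
def intChoose (a : ℕ) (b : ℤ) : ℕ := if 0 ≤ b then a.choose b.toNat else 0

theorem intChoose_succ (a : ℕ) (b : ℤ) :
    intChoose (a + 1) b = intChoose a (b - 1) + intChoose a b := by
  unfold intChoose
  rcases lt_trichotomy b 0 with h | rfl | h
  · rw [if_neg (by omega), if_neg (by omega), if_neg (by omega)]
  · simp
  · obtain ⟨k, rfl⟩ : ∃ k : ℕ, b = k + 1 := ⟨(b - 1).toNat, by omega⟩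
    rw [if_pos (by omega), if_pos (by omega), if_pos (by omega)]
    have h1 : ((k : ℤ) + 1).toNat = k + 1 := by omega
    have h2 : ((k : ℤ) + 1 - 1).toNat = k := by omega
    rw [h1, h2, Nat.choose_succ_succ]

theorem intChoose_of_neg {a : ℕ} {b : ℤ} (h : b < 0) : intChoose a b = 0 :=
  if_neg (by omega)

theorem intChoose_of_gt {a : ℕ} {b : ℤ} (h : a < b) : intChoose a b = 0 := by
  unfold intChoose
  split_ifs
  · exact Nat.choose_eq_zero_of_lt (by omega)
  · rfl

section Gram

variable {R : Type*} [CommRing R]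

/-- The entries of the limiting Gram matrix. -/
def gramEntry (y : R) (j i : ℕ) : R :=
  (1 + y) * intChoose (i + j + 2) (2 * j - i + 1) - y * intChoose (i + j) (2 * j - i)

/-- The four-term recurrence operator on sequences. -/
def fourTerm : (ℕ → R) →ₗ[R] (ℕ → R) where
  toFun a i := match i with
    | 0 => -(a 1 + a 0)
    | 1 => -(a 2 + 3 * a 1 + 2 * a 0)
    | i + 2 => -(a (i + 3) + 3 * a (i + 2) + 3 * a (i + 1) + a i)
  map_add' a b := by
    funext i
    match i with
    | 0 => simp only [Pi.add_apply]; ring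
    | 1 => simp only [Pi.add_apply]; ring
    | i + 2 => simp only [Pi.add_apply]; ring
  map_smul' r a := by
    funext i
    match i with
    | 0 => simp only [Pi.smul_apply, smul_eq_mul, RingHom.id_apply]; ring
    | 1 => simp only [Pi.smul_apply, smul_eq_mul, RingHom.id_apply]; ring
    | i + 2 => simp only [Pi.smul_apply, smul_eq_mul, RingHom.id_apply]; ring

theorem fourTerm_zero (a : ℕ → R) : fourTerm a 0 = -(a 1 + a 0) := rfl

theorem fourTerm_one (a : ℕ → R) : fourTerm a 1 = -(a 2 + 3 * a 1 + 2 * a 0) := rfl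

theorem fourTerm_add_two (a : ℕ → R) (i : ℕ) :
    fourTerm a (i + 2) = -(a (i + 3) + 3 * a (i + 2) + 3 * a (i + 1) + a i) := rfl

theorem intChoose_four_term (a : ℕ) (b : ℤ) :
    intChoose (a + 3) (b - 1) + 3 * intChoose (a + 1) (b + 1) + intChoose a (b + 2)
      = intChoose (a + 3) (b + 2) + 3 * intChoose (a + 1) (b - 2) + intChoose a (b - 4) := by
  simp only [intChoose_succ]
  ring_nf

theorem gramEntry_four_term (y : R) (i j : ℕ) :
    gramEntry y (j + 2) (i + 3) + 3 * gramEntry y (j + 2) (i + 1) + gramEntry y (j + 2) i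
      = gramEntry y (j + 3) (i + 2) + 3 * gramEntry y (j + 1) (i + 2)
        + gramEntry y j (i + 2) := by
  have h1 := congrArg (Nat.cast (R := R)) (intChoose_four_term (i + j + 4) (2 * j - i + 3))
  have h2 := congrArg (Nat.cast (R := R)) (intChoose_four_term (i + j + 2) (2 * j - i + 2))
  unfold gramEntry
  push_cast at h1 h2 ⊢
  ring_nf at h1 h2 ⊢
  linear_combination (1 + y) * h1 - y * h2

theorem gramEntry_eq_zero_of_lt {y : R} {i j : ℕ} (h : 2 * j + 1 < i) : gramEntry y j i = 0 := by
  unfold gramEntry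
  rw [intChoose_of_neg (by omega), intChoose_of_neg (by omega)]
  simp

theorem gramEntry_eq_zero_of_gt {y : R} {i j : ℕ} (h : 2 * i + 1 < j) : gramEntry y j i = 0 := by
  unfold gramEntry
  rw [intChoose_of_gt (by push_cast; omega), intChoose_of_gt (by push_cast; omega)]
  simp

theorem fourTerm_gramEntry (y : R) (i j : ℕ) :
    fourTerm (gramEntry y j) i = fourTerm (fun k => gramEntry y k i) j := by
  match i, j with
  | 0, 0 => simp [fourTerm_zero, gramEntry, intChoose]
  | 0, 1 => simp [fourTerm_zero, fourTerm_one, gramEntry, intChoose, Nat.choose]; ring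
  | 1, 0 => simp [fourTerm_zero, fourTerm_one, gramEntry, intChoose, Nat.choose]; ring
  | 1, 1 => simp [fourTerm_one, gramEntry, intChoose, Nat.choose]
  | 0, 2 => simp [fourTerm_zero, fourTerm_add_two _ 0, gramEntry, intChoose, Nat.choose]; ring
  | 0, 3 => simp [fourTerm_zero, fourTerm_add_two _ 1, gramEntry, intChoose, Nat.choose]
  | 0, j + 4 =>
    rw [fourTerm_zero, fourTerm_add_two]
    simp only [gramEntry_eq_zero_of_gt (show 2 * 0 + 1 < j + 4 by omega),
      gramEntry_eq_zero_of_gt (show 2 * 1 + 1 < j + 4 by omega),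
      gramEntry_eq_zero_of_gt (show 2 * 0 + 1 < j + 2 + 3 by omega),
      gramEntry_eq_zero_of_gt (show 2 * 0 + 1 < j + 2 + 1 by omega),
      gramEntry_eq_zero_of_gt (show 2 * 0 + 1 < j + 2 by omega)]
    ring
  | 2, 0 => simp [fourTerm_zero, fourTerm_add_two _ 0, gramEntry, intChoose]; ring
  | 3, 0 => simp [fourTerm_zero, fourTerm_add_two _ 1, gramEntry, intChoose]
  | i + 4, 0 =>
    rw [fourTerm_zero, fourTerm_add_two]
    simp only [gramEntry_eq_zero_of_lt (show 2 * 0 + 1 < i + 4 by omega),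
      gramEntry_eq_zero_of_lt (show 2 * 1 + 1 < i + 4 by omega),
      gramEntry_eq_zero_of_lt (show 2 * 0 + 1 < i + 2 + 3 by omega),
      gramEntry_eq_zero_of_lt (show 2 * 0 + 1 < i + 2 + 1 by omega),
      gramEntry_eq_zero_of_lt (show 2 * 0 + 1 < i + 2 by omega)]
    ring
  | 1, 2 => simp [fourTerm_one, fourTerm_add_two _ 0, gramEntry, intChoose, Nat.choose]; ring
  | 1, 3 => simp [fourTerm_one, fourTerm_add_two _ 1, gramEntry, intChoose, Nat.choose]; ring
  | 1, 4 => simp [fourTerm_one, fourTerm_add_two _ 2, gramEntry, intChoose, Nat.choose]; ring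
  | 1, 5 => simp [fourTerm_one, fourTerm_add_two _ 3, gramEntry, intChoose, Nat.choose]
  | 1, j + 6 =>
    rw [fourTerm_one, fourTerm_add_two]
    simp only [gramEntry_eq_zero_of_gt (show 2 * 0 + 1 < j + 6 by omega),
      gramEntry_eq_zero_of_gt (show 2 * 1 + 1 < j + 6 by omega),
      gramEntry_eq_zero_of_gt (show 2 * 2 + 1 < j + 6 by omega),
      gramEntry_eq_zero_of_gt (show 2 * 1 + 1 < j + 4 + 3 by omega),
      gramEntry_eq_zero_of_gt (show 2 * 1 + 1 < j + 4 + 1 by omega),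
      gramEntry_eq_zero_of_gt (show 2 * 1 + 1 < j + 4 by omega)]
    ring
  | 2, 1 => simp [fourTerm_one, fourTerm_add_two _ 0, gramEntry, intChoose, Nat.choose]; ring
  | 3, 1 => simp [fourTerm_one, fourTerm_add_two _ 1, gramEntry, intChoose, Nat.choose]; ring
  | 4, 1 => simp [fourTerm_one, fourTerm_add_two _ 2, gramEntry, intChoose]; ring
  | 5, 1 => simp [fourTerm_one, fourTerm_add_two _ 3, gramEntry, intChoose]
  | i + 6, 1 =>
    rw [fourTerm_one, fourTerm_add_two]
    simp only [gramEntry_eq_zero_of_lt (show 2 * 0 + 1 < i + 6 by omega),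
      gramEntry_eq_zero_of_lt (show 2 * 1 + 1 < i + 6 by omega),
      gramEntry_eq_zero_of_lt (show 2 * 2 + 1 < i + 6 by omega),
      gramEntry_eq_zero_of_lt (show 2 * 1 + 1 < i + 4 + 3 by omega),
      gramEntry_eq_zero_of_lt (show 2 * 1 + 1 < i + 4 + 1 by omega),
      gramEntry_eq_zero_of_lt (show 2 * 1 + 1 < i + 4 by omega)]
    ring
  | i + 2, j + 2 =>
    rw [fourTerm_add_two, fourTerm_add_two]
    linear_combination -gramEntry_four_term y i j

open Polynomial

/-- The polynomials that express iterates of the four-term operator. -/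
def fourTermPoly (R : Type*) [CommRing R] : ℕ → R[X]
  | 0 => 1
  | 1 => -(X + 1)
  | 2 => X ^ 2 + 4 * X + 1
  | i + 3 => -((X + 3) * fourTermPoly R (i + 2) + 3 * fourTermPoly R (i + 1) + fourTermPoly R i)

theorem aeval_fourTerm_gramEntry (y : R) (j : ℕ) :
    aeval (fourTerm (R := R)) (fourTermPoly R j) (gramEntry y 0) = gramEntry y j := by
  have key (j : ℕ) : fourTerm (gramEntry y j) = fun i => fourTerm (fun k => gramEntry y k i) j :=
    funext fun i => fourTerm_gramEntry y i j
  induction j using fourTermPoly.induct with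
  | case1 => simp [fourTermPoly]
  | case2 =>
    simp only [fourTermPoly, map_neg, map_add, aeval_X, map_one, LinearMap.neg_apply,
      LinearMap.add_apply, Module.End.one_apply, key]
    funext i
    simp [fourTerm_zero]
  | case3 =>
    have h1 : fourTerm (gramEntry y 0) = -(gramEntry y 1 + gramEntry y 0) := by
      rw [key]; rfl
    simp only [fourTermPoly, map_mul, map_add, aeval_X, map_one, map_ofNat,
      LinearMap.add_apply, Module.End.one_apply, pow_two, Module.End.mul_apply, h1, map_neg, key]
    funext i
    simp [fourTerm_one]
    ring
  | case4 j h2 h1 h0 =>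
    simp only [fourTermPoly, map_neg, map_add, map_mul, aeval_X, map_ofNat, LinearMap.neg_apply,
      LinearMap.add_apply, Module.End.mul_apply, h2, h1, h0, key]
    funext i
    simp [fourTerm_add_two]
    ring

theorem aeval_fourTerm_apply_zero (a : ℕ → R) (i : ℕ) :
    aeval (fourTerm (R := R)) (fourTermPoly R i) a 0 = a i := by
  induction i using fourTermPoly.induct generalizing a with
  | case1 => simp [fourTermPoly]
  | case2 => simp [fourTermPoly, fourTerm_zero]
  | case3 =>
    simp [fourTermPoly, fourTerm_zero, fourTerm_one, pow_two, map_ofNat (aeval fourTerm) 4]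
    ring
  | case4 i h2 h1 h0 =>
    have hc : aeval (fourTerm (R := R)) (fourTermPoly R (i + 3)) =
        -(aeval fourTerm (fourTermPoly R (i + 2)) * (fourTerm + 3)
          + 3 * aeval fourTerm (fourTermPoly R (i + 1)) + aeval fourTerm (fourTermPoly R i)) := by
      rw [fourTermPoly, mul_comm]
      simp [map_ofNat (aeval fourTerm) 3]
    rw [hc]
    simp [h2, h1, h0, fourTerm_add_two]
    ring

theorem fourTermPoly_coeff (i k : ℕ) :
    (fourTermPoly R i).coeff (i + k) = if k = 0 then (-1) ^ i else 0 := by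
  induction i using fourTermPoly.induct generalizing k with
  | case1 => simp [fourTermPoly, coeff_one]
  | case2 =>
    rw [fourTermPoly, add_comm]
    rcases k with _ | k <;> simp [coeff_X, coeff_one]
  | case3 =>
    rw [fourTermPoly, ← C_ofNat, add_comm]
    rcases k with _ | k <;> simp [coeff_X, coeff_one, coeff_X_pow]
    omega
  | case4 i h2 h1 h0 =>
    have e2 := h2 (k + 1)
    have e1 := h1 (k + 2)
    have e0 := h0 (k + 3)
    have e := h2 k
    rw [fourTermPoly, add_mul, ← C_ofNat, show i + 3 + k = i + 2 + k + 1 by ring]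
    simp only [coeff_neg, coeff_add, coeff_X_mul, coeff_C_mul]
    rw [e, show i + 2 + k + 1 = i + 2 + (k + 1) by ring, e2,
      show i + 2 + (k + 1) = i + 1 + (k + 2) by ring, e1,
      show i + 1 + (k + 2) = i + (k + 3) by ring, e0]
    split_ifs <;> simp_all
    ring

theorem fourTermPoly_natDegree_le (i : ℕ) : (fourTermPoly R i).natDegree ≤ i := by
  rw [natDegree_le_iff_coeff_eq_zero]
  intro k hk
  obtain ⟨l, rfl⟩ := Nat.exists_eq_add_of_lt hk
  rw [add_assoc, fourTermPoly_coeff, if_neg (by omega)]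

/-- The Hankel moments attached to the Gram matrix. -/
def hankelMoment (y : R) (k : ℕ) : R := (fourTerm ^ k) (gramEntry y 0) 0

theorem det_gramEntry (y : R) (n : ℕ) :
    (Matrix.of fun i j : Fin n => gramEntry y j i).det
      = (Matrix.of fun i j : Fin n => hankelMoment y (i + j)).det := by
  set L : Matrix (Fin n) (Fin n) R := Matrix.of fun i k => (fourTermPoly R i).coeff k with hL
  have hdet : L.det * L.det = 1 := by
    rw [Matrix.det_of_isLowerTriangular]
    · rw [← Finset.prod_mul_distrib]
      refine Finset.prod_eq_one fun i _ => ?_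
      have := fourTermPoly_coeff (R := R) i 0
      simp only [add_zero, if_true] at this
      rw [hL, Matrix.of_apply, this, ← mul_pow]
      simp
    · intro i j hij
      obtain ⟨l, hl⟩ := Nat.exists_eq_add_of_lt (show (i : ℕ) < j from hij)
      rw [hL, Matrix.of_apply, hl, add_assoc, fourTermPoly_coeff, if_neg (by omega)]
  have hsum (i : Fin n) (a : ℕ → R) : aeval (fourTerm (R := R)) (fourTermPoly R i) a
      = ∑ k : Fin n, L i k • (fourTerm ^ (k : ℕ)) a := by
    rw [aeval_eq_sum_range' (lt_of_le_of_lt (fourTermPoly_natDegree_le _) i.2),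
      ← Fin.sum_univ_eq_sum_range
        (fun k => (fourTermPoly R i).coeff k • (fourTerm (R := R)) ^ k)]
    simp [hL, LinearMap.sum_apply]
  have hD : (Matrix.of fun i j : Fin n => gramEntry y j i)
      = L * (Matrix.of fun i j : Fin n => hankelMoment y (i + j)) * L.transpose := by
    ext i j
    rw [Matrix.of_apply, ← aeval_fourTerm_apply_zero (gramEntry y j) i,
      ← aeval_fourTerm_gramEntry y j, hsum i, hsum j]
    simp only [Matrix.mul_apply, Matrix.transpose_apply, Matrix.of_apply, Finset.sum_mul,
      Finset.sum_apply, Pi.smul_apply, map_sum, map_smul, smul_eq_mul, Finset.mul_sum,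
      hankelMoment, pow_add, Module.End.mul_apply]
    rw [Finset.sum_comm]
    refine Finset.sum_congr rfl fun k _ => Finset.sum_congr rfl fun l _ => ?_
    ring
  rw [hD, Matrix.det_mul, Matrix.det_mul, Matrix.det_transpose, mul_right_comm, hdet, one_mul]

end Gram

section Triangular

variable {K V : Type*} [Field K] [CommRing V] [Algebra K V]

open Submodule in
theorem sub_mem_span_of_mul_shift (a : V) (f g : ℕ → V)
    (hg : ∀ d, a * g d - g (d + 2) ∈ span K (g '' Set.Iio (d + 2)))
    (h0 : f 0 = g 0) (h1 : f 1 - g 1 ∈ span K (g '' Set.Iio 1))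
    (h2 : f 2 - g 2 ∈ span K (g '' Set.Iio 2)) (hf : ∀ d, f (d + 3) = a * f (d + 1)) (d : ℕ) :
    f d - g d ∈ span K (g '' Set.Iio d) := by
  have hmono {i j : ℕ} (h : i ≤ j) : span K (g '' Set.Iio i) ≤ span K (g '' Set.Iio j) :=
    span_mono (Set.image_mono (Set.Iio_subset_Iio h))
  have hmul (d : ℕ) (v : V) (hv : v ∈ span K (g '' Set.Iio d)) :
      a * v ∈ span K (g '' Set.Iio (d + 2)) := by
    have : (span K (g '' Set.Iio d)).map (LinearMap.mulLeft K a)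
        ≤ span K (g '' Set.Iio (d + 2)) := by
      rw [map_span_le]
      rintro _ ⟨e, he, rfl⟩
      have he : e < d := he
      rw [LinearMap.mulLeft_apply, ← sub_add_cancel (a * g e) (g (e + 2))]
      exact add_mem (hmono (by omega) (hg e)) (subset_span ⟨e + 2, by simpa using he, rfl⟩)
    exact this (mem_map_of_mem hv)
  induction d using Nat.strong_induction_on with
  | _ d ih =>
    match d with
    | 0 => simp [h0]
    | 1 => exact h1
    | 2 => exact h2
    | d + 3 =>
      have e : f (d + 3) - g (d + 3)
          = a * (f (d + 1) - g (d + 1)) + (a * g (d + 1) - g (d + 1 + 2)) := by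
        rw [hf]; ring
      rw [e]
      exact add_mem (hmul (d + 1) _ (ih (d + 1) (by omega))) (hg (d + 1))

end Triangular

open Submodule in
theorem det_eq_of_sub_mem_span {K : Type*} [Field K] {N : ℕ} (f g : ℕ → Fin N → K)
    (h : ∀ d, f d - g d ∈ span K (g '' Set.Iio d)) :
    (Matrix.of fun i : Fin N => f i).det = (Matrix.of fun i : Fin N => g i).det := by
  have hc (d : ℕ) : ∃ c : ℕ → K, ∑ e ∈ Finset.range d, c e • g e = f d - g d := by
    have := h d
    rw [← Finset.coe_range d] at this
    obtain ⟨c, hc⟩ := (mem_span_image_finset_iff_exists_fun K).1 this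
    refine ⟨fun e => if he : e ∈ Finset.range d then c ⟨e, he⟩ else 0, ?_⟩
    rw [← hc, ← Finset.sum_coe_sort (Finset.range d)]
    refine Finset.sum_congr rfl fun e _ => ?_
    beta_reduce
    rw [dif_pos e.2]
  choose c hc using hc
  set L : Matrix (Fin N) (Fin N) K :=
    Matrix.of fun i j => if j < i then c i j else if i = j then 1 else 0 with hL
  have hmul : (Matrix.of fun i : Fin N => f i) = L * Matrix.of fun i : Fin N => g i := by
    ext i k
    have h1 : f i = g i + ∑ e ∈ Finset.range i, c i e • g e := by rw [hc]; simp
    have h2 : ∑ e ∈ Finset.range i, c i e * g e k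
        = ∑ j : Fin N, if j < i then c i j * g j k else 0 := by
      simp only [Fin.lt_def]
      rw [Fin.sum_univ_eq_sum_range (fun e => if e < (i : ℕ) then c i e * g e k else 0) N,
        ← Finset.sum_filter]
      congr 1
      ext e
      have := i.2
      simp only [Finset.mem_range, Finset.mem_filter]
      omega
    rw [Matrix.of_apply, h1, Matrix.mul_apply]
    simp only [Pi.add_apply, Finset.sum_apply, Pi.smul_apply, smul_eq_mul]
    rw [h2]
    have h3 : g i k = ∑ j : Fin N, if i = j then g j k else 0 := by simp
    rw [h3, ← Finset.sum_add_distrib]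
    refine Finset.sum_congr rfl fun j _ => ?_
    simp only [hL, Matrix.of_apply]
    rcases lt_trichotomy j i with hji | rfl | hji
    · simp [hji, hji.ne']
    · simp
    · simp [hji.ne, hji.not_gt]
  rw [hmul, Matrix.det_mul, Matrix.det_of_isLowerTriangular]
  · simp [hL]
  · intro i j hij
    have hij : i < j := hij
    simp [hL, hij.ne, hij.not_gt]

theorem sign_riffle (n : ℕ) (ρ : Equiv.Perm (Fin (2 * n)))
    (h : ∀ d, (ρ d : ℕ) = if (d : ℕ) < n then 2 * (d : ℕ) else 4 * n - 1 - 2 * d) :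
    Equiv.Perm.sign ρ = 1 := by
  have inner : ∀ i : Fin (2 * n),
      (∏ j ∈ Finset.Ioi i, if ρ i < ρ j then (1 : ℤˣ) else -1) = (-1) ^ min (i : ℕ) i.rev := by
    intro i
    rw [Finset.prod_ite, Finset.prod_const_one, one_mul, Finset.prod_const]
    congr 1
    have hi := i.2
    by_cases hin : (i : ℕ) < n
    · have : (Finset.Ioi i).filter (fun j => ¬ ρ i < ρ j)
          = (Finset.Iio i).map Fin.revPerm.toEmbedding := by
        ext j
        have hj := j.2
        simp only [Finset.mem_filter, Finset.mem_Ioi, Finset.mem_map_equiv, Finset.mem_Iio,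
          Fin.lt_def, h, Fin.revPerm_symm, Fin.revPerm_apply, Fin.val_rev]
        split_ifs <;> omega
      rw [this, Finset.card_map, Fin.card_Iio, Fin.val_rev]
      omega
    · have : (Finset.Ioi i).filter (fun j => ¬ ρ i < ρ j) = Finset.Ioi i := by
        ext j
        have hj := j.2
        simp only [Finset.mem_filter, Finset.mem_Ioi, Fin.lt_def, h]
        split_ifs <;> omega
      rw [this, Fin.card_Ioi, Fin.val_rev]
      omega
  rw [Equiv.Perm.sign_eq_prod_prod_Ioi]
  simp only [inner]
  refine Finset.prod_involution (fun i _ => i.rev) ?_ ?_ (fun _ _ => Finset.mem_univ _)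
    (fun i _ => Fin.rev_rev i)
  · intro i _
    rw [Fin.rev_rev, min_comm, ← mul_pow]
    simp
  · intro i _ _ hc
    have h1 := congrArg Fin.val hc
    rw [Fin.val_rev] at h1
    have := i.2
    omega

section Reduction

/-- The coordinate in which `z = 1` becomes the origin. -/
def traceCoord (z : ℂ) : ℂ := (z + z⁻¹ - 2) / 3

/-- The reduced numerator entries, up to the factors common to a row or a column. -/
def numFactor (y s : ℂ) (i : ℕ) : ℂ :=
  (s * (1 + s) ^ 2) ^ (i / 2) *
    if i % 2 = 0 then 1 else (1 + s) ^ 2 + y * (1 + s) + y * (1 + y)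

/-- The numerator rows after elimination. -/
def numRow (y z : ℂ) : ℕ → ℂ
  | 0 => z - z⁻¹
  | i + 1 => 3 ^ (i + 1 + (i + 1) / 2) * ((traceCoord z - y) * (z - z⁻¹)) *
      numFactor y (traceCoord z) i

/-- The denominator rows after elimination. -/
def denRow (y z : ℂ) : ℕ → ℂ
  | 0 => z - z⁻¹
  | i + 1 => 3 ^ (i + 1) * ((traceCoord z - y) * (z - z⁻¹)) * traceCoord z ^ i

theorem numRow_sub_mem_span {J : Type*} (y : ℂ) (z : J → ℂ) (hz : ∀ c, z c ≠ 0)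
    (g : ℕ → J → ℂ) (hg : g = fun d c => z c ^ (d / 2 + d + 1) - (z c)⁻¹ ^ (d / 2 + d + 1)) (d : ℕ) :
    (fun c => numRow y (z c) d) - g d ∈ Submodule.span ℂ (g '' Set.Iio d) := by
  have hmem {i j : ℕ} (h : i < j) (r : ℂ) : r • g i ∈ Submodule.span ℂ (g '' Set.Iio j) :=
    Submodule.smul_mem _ _ (Submodule.subset_span ⟨i, h, rfl⟩)
  have hzw (c : J) : z c * (z c)⁻¹ = 1 := mul_inv_cancel₀ (hz c)
  refine sub_mem_span_of_mul_shift (K := ℂ) (fun c => z c ^ 3 + (z c)⁻¹ ^ 3 - 2)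
    (fun d c => numRow y (z c) d) g ?_ ?_ ?_ ?_ ?_ d
  · intro d
    match d with
    | 0 =>
      have e : (fun c => z c ^ 3 + (z c)⁻¹ ^ 3 - 2) * g 0 - g (0 + 2)
          = (-1 : ℂ) • g 1 + (-2 : ℂ) • g 0 := by
        funext c
        simp only [hg, Pi.sub_apply, Pi.mul_apply, Pi.add_apply, Pi.smul_apply, smul_eq_mul]
        norm_num
        linear_combination ((z c)⁻¹ ^ 2 - z c ^ 2) * hzw c
      rw [e]
      exact add_mem (hmem (by omega) _) (hmem (by omega) _)
    | 1 =>
      have e : (fun c => z c ^ 3 + (z c)⁻¹ ^ 3 - 2) * g 1 - g (1 + 2)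
          = (-1 : ℂ) • g 0 + (-2 : ℂ) • g 1 := by
        funext c
        simp only [hg, Pi.sub_apply, Pi.mul_apply, Pi.add_apply, Pi.smul_apply, smul_eq_mul]
        norm_num
        linear_combination ((z c)⁻¹ - z c) * (z c * (z c)⁻¹ + 1) * hzw c
      rw [e]
      exact add_mem (hmem (by omega) _) (hmem (by omega) _)
    | d + 2 =>
      have e : (fun c => z c ^ 3 + (z c)⁻¹ ^ 3 - 2) * g (d + 2) - g (d + 2 + 2)
          = (1 : ℂ) • g d + (-2 : ℂ) • g (d + 2) := by
        funext c
        have h3 : z c ^ 3 * (z c)⁻¹ ^ 3 = 1 := by rw [← mul_pow, hzw, one_pow]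
        have h1 : (d + 2) / 2 + (d + 2) + 1 = d / 2 + d + 1 + 3 := by omega
        have h2 : (d + 2 + 2) / 2 + (d + 2 + 2) + 1 = d / 2 + d + 1 + 6 := by omega
        simp only [hg, Pi.sub_apply, Pi.mul_apply, Pi.add_apply, Pi.smul_apply, smul_eq_mul,
          h1, h2]
        generalize d / 2 + d + 1 = m
        linear_combination (z c ^ m - (z c)⁻¹ ^ m) * h3
      rw [e]
      exact add_mem (hmem (by omega) _) (hmem (by omega) _)
  · funext c
    simp [numRow, hg]
  · have e : (fun c => numRow y (z c) 1) - g 1 = (-(2 + 3 * y)) • g 0 := by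
      funext c
      simp only [hg, Pi.sub_apply, Pi.smul_apply, smul_eq_mul, numRow, numFactor, traceCoord]
      norm_num
      ring
    rw [e]
    exact hmem (by omega) _
  · have e : (fun c => numRow y (z c) 2) - g 2
        = (-1 : ℂ) • g 1 + (-(2 + 27 * (y * (1 + y) ^ 2))) • g 0 := by
      funext c
      simp only [hg, Pi.sub_apply, Pi.add_apply, Pi.smul_apply, smul_eq_mul, numRow, numFactor,
        traceCoord]
      have h := hzw c
      generalize (z c)⁻¹ = w at h ⊢
      norm_num
      linear_combination (2 * z c ^ 2 - 2 * w ^ 2) * h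
    rw [e]
    exact add_mem (hmem (by omega) _) (hmem (by omega) _)
  · intro d
    funext c
    have h1 : (d + 2) / 2 = d / 2 + 1 := by omega
    have h2 : (d + 2 + 1) / 2 = (d + 1) / 2 + 1 := by omega
    have h3 : (d + 2) % 2 = d % 2 := by omega
    have h27 : z c ^ 3 + (z c)⁻¹ ^ 3 - 2 = 27 * (traceCoord (z c) * (1 + traceCoord (z c)) ^ 2) := by
      have h := hzw c
      unfold traceCoord
      linear_combination (-3 * z c - 3 * (z c)⁻¹) * h
    simp only [Pi.mul_apply, numRow, numFactor, h1, h2, h3, h27]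
    ring

theorem denRow_sub_mem_span {J : Type*} (y : ℂ) (z : J → ℂ) (hz : ∀ c, z c ≠ 0)
    (g : ℕ → J → ℂ) (hg : g = fun d c => z c ^ (d + 1) - (z c)⁻¹ ^ (d + 1)) (d : ℕ) :
    (fun c => denRow y (z c) d) - g d ∈ Submodule.span ℂ (g '' Set.Iio d) := by
  have hmem {i j : ℕ} (h : i < j) (r : ℂ) : r • g i ∈ Submodule.span ℂ (g '' Set.Iio j) :=
    Submodule.smul_mem _ _ (Submodule.subset_span ⟨i, h, rfl⟩)
  have hzw (c : J) : z c * (z c)⁻¹ = 1 := mul_inv_cancel₀ (hz c)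
  refine sub_mem_span_of_mul_shift (K := ℂ) (fun c => (z c + (z c)⁻¹ - 2) ^ 2)
    (fun d c => denRow y (z c) d) g ?_ ?_ ?_ ?_ ?_ d
  · intro d
    match d with
    | 0 =>
      have e : (fun c => (z c + (z c)⁻¹ - 2) ^ 2) * g 0 - g (0 + 2)
          = (-4 : ℂ) • g 1 + (5 : ℂ) • g 0 := by
        funext c
        simp only [hg, Pi.sub_apply, Pi.mul_apply, Pi.add_apply, Pi.smul_apply, smul_eq_mul]
        norm_num
        linear_combination (z c - (z c)⁻¹) * hzw c
      rw [e]
      exact add_mem (hmem (by omega) _) (hmem (by omega) _)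
    | 1 =>
      have e : (fun c => (z c + (z c)⁻¹ - 2) ^ 2) * g 1 - g (1 + 2)
          = (-4 : ℂ) • g 2 + (6 : ℂ) • g 1 + (-4 : ℂ) • g 0 := by
        funext c
        simp only [hg, Pi.sub_apply, Pi.mul_apply, Pi.add_apply, Pi.smul_apply, smul_eq_mul]
        norm_num
        linear_combination (2 * z c ^ 2 - 2 * (z c)⁻¹ ^ 2 - 4 * z c + 4 * (z c)⁻¹) * hzw c
      rw [e]
      exact add_mem (add_mem (hmem (by omega) _) (hmem (by omega) _)) (hmem (by omega) _)
    | d + 2 =>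
      have e : (fun c => (z c + (z c)⁻¹ - 2) ^ 2) * g (d + 2) - g (d + 2 + 2)
          = (-4 : ℂ) • g (d + 3) + (6 : ℂ) • g (d + 2) + (-4 : ℂ) • g (d + 1)
            + (1 : ℂ) • g d := by
        funext c
        simp only [hg, Pi.sub_apply, Pi.mul_apply, Pi.add_apply, Pi.smul_apply, smul_eq_mul]
        have h := hzw c
        generalize (z c)⁻¹ = w at h ⊢
        have e1 : z c * w ^ (d + 3) = w ^ (d + 2) := by linear_combination w ^ (d + 2) * h
        have e2 : z c ^ 2 * w ^ (d + 3) = w ^ (d + 1) := by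
          linear_combination (z c * w + 1) * w ^ (d + 1) * h
        have e3 : w * z c ^ (d + 3) = z c ^ (d + 2) := by linear_combination z c ^ (d + 2) * h
        have e4 : w ^ 2 * z c ^ (d + 3) = z c ^ (d + 1) := by
          linear_combination (z c * w + 1) * z c ^ (d + 1) * h
        linear_combination e4 - e2 - 4 * e3 + 4 * e1 + 2 * (z c ^ (d + 3) - w ^ (d + 3)) * h
      rw [e]
      exact add_mem (add_mem (add_mem (hmem (by omega) _) (hmem (by omega) _))
        (hmem (by omega) _)) (hmem (by omega) _)
  · funext c
    simp [denRow, hg]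
  · have e : (fun c => denRow y (z c) 1) - g 1 = (-(2 + 3 * y)) • g 0 := by
      funext c
      simp only [hg, Pi.sub_apply, Pi.smul_apply, smul_eq_mul, denRow, traceCoord]
      norm_num
      ring
    rw [e]
    exact hmem (by omega) _
  · have e : (fun c => denRow y (z c) 2) - g 2
        = (-(4 + 3 * y)) • g 1 + (5 + 6 * y) • g 0 := by
      funext c
      simp only [hg, Pi.sub_apply, Pi.add_apply, Pi.smul_apply, smul_eq_mul, denRow, traceCoord]
      norm_num
      linear_combination (z c - (z c)⁻¹) * hzw c
    rw [e]
    exact add_mem (hmem (by omega) _) (hmem (by omega) _)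
  · intro d
    funext c
    simp only [Pi.mul_apply, denRow]
    have h9 : (z c + (z c)⁻¹ - 2) ^ 2 = 9 * traceCoord (z c) ^ 2 := by
      unfold traceCoord
      ring
    rw [h9]
    ring

end Reduction

theorem det_eq_of_last_column {N : ℕ} (M : Matrix (Fin (N + 1)) (Fin (N + 1)) ℂ) (a k : Fin N → ℂ)
    (F : Matrix (Fin N) (Fin N) ℂ) (hl : ∀ i : Fin N, M i.succ (Fin.last N) = 0)
    (h : ∀ i c : Fin N, M i.succ c.castSucc = a i * k c * F i c) :
    M.det = (-1) ^ N * M 0 (Fin.last N) * ((∏ i, a i) * (∏ c, k c)) * F.det := by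
  have h1 : M.submatrix Fin.succ Fin.castSucc
      = Matrix.of fun i c => a i * (Matrix.of fun i c => k c * F i c) i c := by
    ext i c
    simp [h, mul_assoc]
  rw [Matrix.det_succ_column M (Fin.last N), Fin.sum_univ_succ, Finset.sum_eq_zero]
  · simp only [Fin.succAbove_last, Fin.succAbove_zero, h1, Matrix.det_mul_column,
      Matrix.det_mul_row]
    simp
    ring
  · intro i _
    rw [hl]
    ring

theorem sdet_eq_sign_mul_det (N : ℕ) (e : Fin N → ℕ) (z : Fin N → ℂ) :
    sdet N e z = Equiv.Perm.sign (Fin.revPerm : Equiv.Perm (Fin N)) *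
      (Matrix.of fun i c : Fin N => z c ^ e i.rev - (z c)⁻¹ ^ e i.rev).det := by
  have := Matrix.det_permute (Fin.revPerm : Equiv.Perm (Fin N))
    (Matrix.of fun i c : Fin N => z c ^ e i.rev - (z c)⁻¹ ^ e i.rev)
  rw [← this]
  unfold sdet
  congr 1
  ext i c
  simp

theorem sdet_muE_eq {n : ℕ} (z : Fin (2 * n + 1) → ℂ) (hz : ∀ c, z c ≠ 0) :
    sdet (2 * n + 1) (muE (2 * n + 1)) z =
      Equiv.Perm.sign (Fin.revPerm : Equiv.Perm (Fin (2 * n + 1))) *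
      (z (Fin.last _) - (z (Fin.last _))⁻¹) *
      ((∏ i : Fin (2 * n), 3 ^ (i + 1 + (i + 1) / 2 : ℕ)) *
        ∏ c : Fin (2 * n), ((traceCoord (z c.castSucc) - traceCoord (z (Fin.last _))) *
          (z c.castSucc - (z c.castSucc)⁻¹))) *
      (Matrix.of fun i c : Fin (2 * n) =>
        numFactor (traceCoord (z (Fin.last _))) (traceCoord (z c.castSucc)) i).det := by
  have h1 := det_eq_of_sub_mem_span _ _
    (numRow_sub_mem_span (traceCoord (z (Fin.last _))) z hz _ rfl)
  have h2 := det_eq_of_last_column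
    (Matrix.of fun i c : Fin (2 * n + 1) => numRow (traceCoord (z (Fin.last _))) (z c) i)
    (fun i => 3 ^ (i + 1 + (i + 1) / 2 : ℕ))
    (fun c => (traceCoord (z c.castSucc) - traceCoord (z (Fin.last _))) *
          (z c.castSucc - (z c.castSucc)⁻¹))
    (Matrix.of fun i c : Fin (2 * n) =>
        numFactor (traceCoord (z (Fin.last _))) (traceCoord (z c.castSucc)) i)
    (fun i => by simp [numRow]) (fun i c => by simp [numRow])
  have h3 : (Matrix.of fun i c : Fin (2 * n + 1) =>
      z c ^ muE (2 * n + 1) i.rev - (z c)⁻¹ ^ muE (2 * n + 1) i.rev)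
      = Matrix.of fun i : Fin (2 * n + 1) => fun c =>
        z c ^ ((i : ℕ) / 2 + i + 1) - (z c)⁻¹ ^ ((i : ℕ) / 2 + i + 1) := by
    ext i c
    have e : muE (2 * n + 1) i.rev = (i : ℕ) / 2 + i + 1 := by
      have := i.2
      rw [muE, Fin.val_rev, show 2 * n + 1 - (2 * n + 1 - ((i : ℕ) + 1)) = i + 1 by omega]
      omega
    rw [Matrix.of_apply, e]
    rfl
  rw [sdet_eq_sign_mul_det, h3, ← h1]
  refine (congrArg _ h2).trans ?_
  simp [numRow, mul_assoc]

theorem sdet_deltaE_eq {n : ℕ} (z : Fin (2 * n + 1) → ℂ) (hz : ∀ c, z c ≠ 0) :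
    sdet (2 * n + 1) (deltaE (2 * n + 1)) z =
      Equiv.Perm.sign (Fin.revPerm : Equiv.Perm (Fin (2 * n + 1))) *
      (z (Fin.last _) - (z (Fin.last _))⁻¹) *
      ((∏ i : Fin (2 * n), 3 ^ (i + 1 : ℕ)) *
        ∏ c : Fin (2 * n), ((traceCoord (z c.castSucc) - traceCoord (z (Fin.last _))) *
          (z c.castSucc - (z c.castSucc)⁻¹))) *
      (Matrix.of fun i c : Fin (2 * n) => traceCoord (z c.castSucc) ^ (i : ℕ)).det := by
  have h1 := det_eq_of_sub_mem_span _ _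
    (denRow_sub_mem_span (traceCoord (z (Fin.last _))) z hz _ rfl)
  have h2 := det_eq_of_last_column
    (Matrix.of fun i c : Fin (2 * n + 1) => denRow (traceCoord (z (Fin.last _))) (z c) i)
    (fun i => 3 ^ (i + 1 : ℕ))
    (fun c => (traceCoord (z c.castSucc) - traceCoord (z (Fin.last _))) *
          (z c.castSucc - (z c.castSucc)⁻¹))
    (Matrix.of fun i c : Fin (2 * n) => traceCoord (z c.castSucc) ^ (i : ℕ))
    (fun i => by simp [denRow]) (fun i c => by simp [denRow])
  have h3 : (Matrix.of fun i c : Fin (2 * n + 1) =>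
      z c ^ deltaE (2 * n + 1) i.rev - (z c)⁻¹ ^ deltaE (2 * n + 1) i.rev)
      = Matrix.of fun i : Fin (2 * n + 1) => fun c =>
        z c ^ ((i : ℕ) + 1) - (z c)⁻¹ ^ ((i : ℕ) + 1) := by
    ext i c
    have e : deltaE (2 * n + 1) i.rev = (i : ℕ) + 1 := by
      have := i.2
      rw [deltaE, Fin.val_rev]
      omega
    rw [Matrix.of_apply, e]
    rfl
  rw [sdet_eq_sign_mul_det, h3, ← h1]
  refine (congrArg _ h2).trans ?_
  simp [denRow, mul_assoc]

section Expansion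

open Polynomial

/-- The successive remainders in the expansion of the numerator factor. -/
def hankelPoly (y : ℂ) : ℕ → ℂ[X]
  | 0 => C (2 + y) + C (1 + y) * X
  | m + 1 => -((1 + X) ^ 2 * divX ((1 + X) * hankelPoly y m))

theorem hankelPoly_coeff (y : ℂ) (m i : ℕ) :
    (hankelPoly y m).coeff i = (fourTerm ^ m) (gramEntry y 0) i := by
  induction m generalizing i with
  | zero =>
    rw [pow_zero, Module.End.one_apply, hankelPoly]
    match i with
    | 0 => simp [gramEntry, intChoose]; ring
    | 1 => simp [gramEntry, intChoose]
    | i + 2 =>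
      rw [gramEntry_eq_zero_of_lt (by omega)]
      simp [coeff_one]
  | succ m ih =>
    have ih' : (hankelPoly y m).coeff = (fourTerm ^ m) (gramEntry y 0) := funext ih
    rw [pow_succ', Module.End.mul_apply, ← ih', hankelPoly,
      show (1 + X : ℂ[X]) ^ 2 = 1 + C 2 * X + X * X by rw [C_ofNat]; ring]
    match i with
    | 0 => simp [fourTerm_zero, add_mul, mul_assoc, coeff_divX]
    | 1 =>
      simp [fourTerm_one, add_mul, mul_assoc, coeff_divX]
      ring
    | i + 2 =>
      simp [fourTerm_add_two, add_mul, mul_assoc, coeff_divX]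
      ring

theorem eval_hankelPoly (y t : ℂ) (ht : 1 + t ≠ 0) (m : ℕ) :
    (1 + t) * (hankelPoly y m).eval t = hankelMoment y m
      + -t / (1 + t) ^ 3 * ((1 + t) * (hankelPoly y (m + 1)).eval t) := by
  have h := congrArg (eval t) (divX_mul_X_add ((1 + X) * hankelPoly y m))
  simp only [eval_add, eval_mul, eval_X, eval_C, eval_one, mul_coeff_zero, coeff_add,
    coeff_one_zero, coeff_X_zero, add_zero, one_mul, hankelPoly_coeff] at h
  rw [hankelMoment, ← h, hankelPoly]
  simp only [eval_neg, eval_mul, eval_pow, eval_add, eval_one, eval_X]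
  field_simp
  ring

/-- The coefficients of the numerator factor in powers of the cubic coordinate. -/
def numCoeff (y : ℂ) : ℕ → ℂ
  | 0 => 1 + y + y * (1 + y)
  | m + 1 => hankelMoment y m

theorem numFactor_expansion (y t : ℂ) (ht : 1 + t ≠ 0) (m : ℕ) :
    ((1 + t)⁻¹) ^ 2 + y * (1 + t)⁻¹ + y * (1 + y)
      = ∑ k ∈ Finset.range (m + 1), numCoeff y k * (-t / (1 + t) ^ 3) ^ k
        + (-t / (1 + t) ^ 3) ^ (m + 1) * ((1 + t) * (hankelPoly y m).eval t) := by
  induction m with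
  | zero =>
    simp [numCoeff, hankelPoly]
    field_simp
    ring
  | succ m ih =>
    rw [Finset.sum_range_succ, ih, eval_hankelPoly y t ht m, numCoeff]
    ring

end Expansion

/-- The permutation that lists the even numbers upwards, then the odd numbers downwards. -/
def riffle (n : ℕ) : Equiv.Perm (Fin (2 * n)) where
  toFun d := ⟨if (d : ℕ) < n then 2 * (d : ℕ) else 4 * n - 1 - 2 * d, by
    have := d.2
    split_ifs <;> omega⟩
  invFun d := ⟨if (d : ℕ) % 2 = 0 then d / 2 else 2 * n - 1 - d / 2, by
    have := d.2
    split_ifs <;> omega⟩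
  left_inv d := by
    have := d.2
    ext
    simp only
    split_ifs <;> omega
  right_inv d := by
    have := d.2
    ext
    simp only
    split_ifs <;> omega

/-- The coefficients of the numerator factors in powers of the cubic coordinate. -/
def numMatrix (y : ℂ) (n : ℕ) : Matrix (Fin (2 * n)) (Fin (2 * n)) ℂ :=
  Matrix.of fun i m =>
    if (i : ℕ) % 2 = 0 then (if (m : ℕ) = i / 2 then 1 else 0)
    else (if (i : ℕ) / 2 ≤ m then numCoeff y (m - i / 2) else 0)

theorem det_numMatrix (y : ℂ) (n : ℕ) :
    (numMatrix y n).det = (Matrix.of fun i j : Fin n => gramEntry y j i).det := by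
  have h1 := Matrix.det_permute (riffle n) (numMatrix y n)
  rw [sign_riffle n (riffle n) fun d => rfl, Units.val_one, Int.cast_one, one_mul] at h1
  set ε : Fin n ⊕ Fin n ≃ Fin (2 * n) := finSumFinEquiv.trans (finCongr (two_mul n).symm) with hε
  have hl (i : Fin n) : (ε (Sum.inl i) : ℕ) = i := by simp [hε]
  have hr (i : Fin n) : (ε (Sum.inr i) : ℕ) = n + i := by simp [hε, add_comm]
  set S := (numMatrix y n).submatrix (riffle n) id with hS
  have hblock : S.submatrix ε ε = Matrix.fromBlocks 1 0 (S.submatrix ε ε).toBlocks₂₁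
      (Matrix.of fun i j : Fin n => hankelMoment y (i + j)) := by
    rw [← Matrix.fromBlocks_toBlocks (S.submatrix ε ε)]
    congr 1
    · ext i j
      have hi := i.2
      simp [hS, Matrix.toBlocks₁₁, numMatrix, riffle, hl, Matrix.one_apply, Fin.ext_iff, eq_comm]
    · ext i j
      have hi := i.2
      simp [hS, Matrix.toBlocks₁₂, numMatrix, riffle, hl, hr]
      omega
    · ext i j
      have hi := i.2
      have e1 : (4 * n - 1 - 2 * (n + (i : ℕ))) % 2 = 1 := by omega
      have e2 : (4 * n - 1 - 2 * (n + (i : ℕ))) / 2 = n - 1 - i := by omega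
      have e3 : n - 1 - (i : ℕ) ≤ n + j := by omega
      have e4 : n + (j : ℕ) - (n - 1 - i) = (i + j) + 1 := by omega
      simp [hS, Matrix.toBlocks₂₂, numMatrix, riffle, hr, e1, e2, e3, e4, numCoeff]
  rw [det_gramEntry, ← h1, ← Matrix.det_submatrix_equiv_self ε, hblock,
    Matrix.det_fromBlocks_zero₁₂, Matrix.det_one, one_mul]

theorem numFactor_eq_sum (y s : ℂ) (hs : 1 + s ≠ 0) {n : ℕ} (i : Fin (2 * n)) :
    numFactor y s i = ∑ m, numMatrix y n i m * (s * (1 + s) ^ 2) ^ (m : ℕ)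
      + (s * (1 + s) ^ 2) ^ (2 * n) * (if (i : ℕ) % 2 = 0 then 0 else
        (1 + -s / (1 + s)) * (hankelPoly y (2 * n - 1 - i / 2)).eval (-s / (1 + s))) := by
  have hi := i.2
  by_cases hi2 : (i : ℕ) % 2 = 0
  · rw [Finset.sum_eq_single (⟨i / 2, by omega⟩ : Fin (2 * n))]
    · simp [numFactor, numMatrix, hi2]
    · intro m _ hm
      rw [Ne, Fin.ext_iff] at hm
      simp [numMatrix, hi2, hm]
    · simp
  · obtain ⟨k, l, hk, hl⟩ : ∃ k l, (i : ℕ) / 2 = k ∧ 2 * n = k + (l + 1) :=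
      ⟨i / 2, 2 * n - i / 2 - 1, rfl, by omega⟩
    have hl' : 2 * n - 1 - (i : ℕ) / 2 = l := by omega
    have h1 : 1 + -s / (1 + s) = (1 + s)⁻¹ := by field_simp; ring
    have hT : -(-s / (1 + s)) / (1 + -s / (1 + s)) ^ 3 = s * (1 + s) ^ 2 := by
      rw [h1]; field_simp
    have hexp := numFactor_expansion y (-s / (1 + s)) (by rw [h1]; exact inv_ne_zero hs) l
    rw [hT] at hexp
    rw [h1, inv_inv] at hexp
    have hsum : ∑ m, numMatrix y n i m * (s * (1 + s) ^ 2) ^ (m : ℕ)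
        = (s * (1 + s) ^ 2) ^ k *
          ∑ j ∈ Finset.range (l + 1), numCoeff y j * (s * (1 + s) ^ 2) ^ j := by
      simp only [numMatrix, Matrix.of_apply, if_neg hi2, hk]
      rw [Fin.sum_univ_eq_sum_range (fun m => (if k ≤ m then numCoeff y (m - k)
        else 0) * (s * (1 + s) ^ 2) ^ m) (2 * n), hl, Finset.sum_range_add,
        Finset.sum_eq_zero, zero_add, Finset.mul_sum]
      · refine Finset.sum_congr rfl fun j _ => ?_
        rw [if_pos (by omega), Nat.add_sub_cancel_left, pow_add]
        ring
      · intro m hm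
        rw [if_neg (by simpa using hm), zero_mul]
    rw [hsum, numFactor, if_neg hi2, if_neg hi2, hexp, hl', h1, hk,
      show (s * (1 + s) ^ 2) ^ (2 * n) = (s * (1 + s) ^ 2) ^ k * (s * (1 + s) ^ 2) ^ (l + 1) by
        rw [← pow_add, hl]]
    ring

open Filter Topology in
theorem tendsto_det_div_pow {α ι : Type*} [Fintype ι] [DecidableEq ι] {l : Filter α}
    {κ : ι → ℕ} {K : ℕ} (hκ : ∀ m, κ m < K) {e : α → ℂ} (he : Tendsto e l (𝓝 0))
    (he0 : ∀ᶠ a in l, e a ≠ 0) {w : ι → α → ℂ} {w₀ : ι → ℂ}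
    (hw : ∀ c, Tendsto (w c) l (𝓝 (w₀ c)))
    (hV : (Matrix.of fun m c => w₀ c ^ κ m).det ≠ 0) {C : Matrix ι ι ℂ}
    {R : α → Matrix ι ι ℂ} {R₀ : Matrix ι ι ℂ} (hR : Tendsto R l (𝓝 R₀))
    {f : α → Matrix ι ι ℂ}
    (hf : ∀ᶠ a in l, ∀ r c, f a r c = ∑ m, C r m * (e a * w c a) ^ κ m + e a ^ K * R a r c) :
    Tendsto (fun a => (f a).det / e a ^ ∑ m, κ m) l
      (𝓝 (C.det * (Matrix.of fun m c => w₀ c ^ κ m).det)) := by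
  set V : α → Matrix ι ι ℂ := fun a => Matrix.of fun m c => w c a ^ κ m with hVdef
  set V₀ : Matrix ι ι ℂ := Matrix.of fun m c => w₀ c ^ κ m with hV₀def
  have hVt : Tendsto V l (𝓝 V₀) := by
    refine tendsto_pi_nhds.2 fun m => tendsto_pi_nhds.2 fun c => ?_
    exact (hw c).pow (κ m)
  have hdet : Tendsto (fun a => (V a).det) l (𝓝 V₀.det) :=
    (continuous_id.matrix_det.tendsto V₀).comp hVt
  have hadj : Tendsto (fun a => (V a).adjugate) l (𝓝 V₀.adjugate) :=
    (continuous_id.matrix_adjugate.tendsto V₀).comp hVt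
  have hRV : Tendsto (fun a => R a * (V a).adjugate) l (𝓝 (R₀ * V₀.adjugate)) := hR.mul hadj
  set E : α → Matrix ι ι ℂ := fun a => Matrix.of fun r m =>
    e a ^ (K - κ m) * (((V a).det)⁻¹ * (R a * (V a).adjugate) r m) with hE
  have hEt : Tendsto E l (𝓝 0) := by
    refine tendsto_pi_nhds.2 fun r => tendsto_pi_nhds.2 fun m => ?_
    have h1 : Tendsto (fun a => e a ^ (K - κ m)) l (𝓝 0) := by
      have := he.pow (K - κ m)
      rwa [zero_pow (Nat.sub_ne_zero_of_lt (hκ m))] at this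
    have h2 : Tendsto (fun a => (R a * (V a).adjugate) r m) l (𝓝 ((R₀ * V₀.adjugate) r m)) :=
      tendsto_pi_nhds.1 (tendsto_pi_nhds.1 hRV r) m
    simpa [hE] using h1.mul ((hdet.inv₀ hV).mul h2)
  have hCE : Tendsto (fun a => (C + E a).det) l (𝓝 C.det) := by
    have h1 : Tendsto (fun a => C + E a) l (𝓝 C) := by simpa using hEt.const_add C
    exact (continuous_id.matrix_det.tendsto C).comp h1
  refine (hCE.mul hdet).congr' ?_
  filter_upwards [hf, he0, hdet.eventually_ne hV] with a hfa ha hVa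
  have hfact : f a = (C + E a) * Matrix.diagonal (fun m => e a ^ κ m) * V a := by
    have h1 : E a * Matrix.diagonal (fun m => e a ^ κ m)
        = (e a ^ K * (V a).det⁻¹) • (R a * (V a).adjugate) := by
      ext r m
      rw [Matrix.mul_diagonal, Matrix.smul_apply, smul_eq_mul]
      simp only [hE, Matrix.of_apply]
      rw [← Nat.sub_add_cancel (hκ m).le, pow_add, Nat.add_sub_cancel]
      ring
    rw [Matrix.add_mul, Matrix.add_mul, h1, Matrix.smul_mul, Matrix.mul_assoc (R a),
      Matrix.adjugate_mul]
    ext r c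
    rw [hfa, Matrix.add_apply, Matrix.mul_apply]
    congr 1
    · refine Finset.sum_congr rfl fun m _ => ?_
      rw [Matrix.mul_diagonal, mul_pow, mul_assoc]
      rfl
    · rw [Matrix.mul_smul, Matrix.mul_one, smul_smul, mul_assoc, inv_mul_cancel₀ hVa, mul_one,
        Matrix.smul_apply, smul_eq_mul]
  rw [hfact, Matrix.det_mul, Matrix.det_mul, Matrix.det_diagonal, Finset.prod_pow_eq_pow_sum]
  field_simp

open Filter Topology in
theorem tendsto_det_numFactor_div {α : Type*} {l : Filter α} (y : ℂ) {n : ℕ} {e : α → ℂ}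
    (he : Tendsto e l (𝓝 0)) (he0 : ∀ᶠ a in l, e a ≠ 0) {σ : Fin (2 * n) → α → ℂ}
    {w₀ : Fin (2 * n) → ℂ} (hw₀ : Function.Injective w₀)
    (hσ : ∀ c, Tendsto (σ c) l (𝓝 (w₀ c))) :
    (∀ᶠ a in l, (Matrix.of fun i c : Fin (2 * n) => (e a * σ c a) ^ (i : ℕ)).det ≠ 0) ∧
    Tendsto (fun a => (Matrix.of fun i c : Fin (2 * n) => numFactor y (e a * σ c a) i).det /
      (Matrix.of fun i c : Fin (2 * n) => (e a * σ c a) ^ (i : ℕ)).det) l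
      (𝓝 (Matrix.of fun i j : Fin n => gramEntry y j i).det) := by
  have hs (c : Fin (2 * n)) : Tendsto (fun a => e a * σ c a) l (𝓝 0) := by
    simpa using he.mul (hσ c)
  have hV : (Matrix.of fun (m : Fin (2 * n)) c => w₀ c ^ (m : ℕ)).det ≠ 0 := by
    have h := Matrix.det_vandermonde_ne_zero_iff.2 hw₀
    rw [← Matrix.det_transpose] at h
    exact h
  have hden := tendsto_det_div_pow (κ := fun m : Fin (2 * n) => (m : ℕ)) (K := 2 * n)
    (fun m => m.2) he he0 hσ hV (C := 1) (R := fun _ => 0) (R₀ := 0) tendsto_const_nhds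
    (f := fun a => Matrix.of fun i c : Fin (2 * n) => (e a * σ c a) ^ (i : ℕ))
    (Eventually.of_forall fun a r c => by simp [Matrix.one_apply])
  rw [Matrix.det_one, one_mul] at hden
  have hp (c : Fin (2 * n)) : Tendsto (fun a => 1 + e a * σ c a) l (𝓝 1) := by
    simpa using (hs c).const_add 1
  have ht (c : Fin (2 * n)) :
      Tendsto (fun a => -(e a * σ c a) / (1 + e a * σ c a)) l (𝓝 0) := by
    have h := (hs c).neg.div (hp c) one_ne_zero
    rw [neg_zero, zero_div] at h
    exact h
  have hw (c : Fin (2 * n)) :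
      Tendsto (fun a => σ c a * (1 + e a * σ c a) ^ 2) l (𝓝 (w₀ c)) := by
    simpa using (hσ c).mul ((hp c).pow 2)
  have hR (i c : Fin (2 * n)) : ∃ r, Tendsto (fun a =>
      (σ c a * (1 + e a * σ c a) ^ 2) ^ (2 * n) * (if (i : ℕ) % 2 = 0 then 0 else
        (1 + -(e a * σ c a) / (1 + e a * σ c a)) * (hankelPoly y (2 * n - 1 - i / 2)).eval
          (-(e a * σ c a) / (1 + e a * σ c a)))) l (𝓝 r) := by
    split_ifs
    · exact ⟨0, by simpa using tendsto_const_nhds⟩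
    · exact ⟨_, ((hw c).pow _).mul (((ht c).const_add 1).mul
        (((hankelPoly y _).continuous.tendsto 0).comp (ht c)))⟩
  choose R₀ hR₀ using hR
  have hnum := tendsto_det_div_pow (κ := fun m : Fin (2 * n) => (m : ℕ)) (K := 2 * n)
    (fun m => m.2) he he0 hw hV (C := numMatrix y n) (R₀ := R₀)
    (tendsto_pi_nhds.2 fun i => tendsto_pi_nhds.2 fun c => hR₀ i c)
    (f := fun a => Matrix.of fun i c : Fin (2 * n) => numFactor y (e a * σ c a) i) (by
      filter_upwards [eventually_all.2 fun c => (hp c).eventually_ne one_ne_zero] with a ha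
      intro i c
      rw [Matrix.of_apply, numFactor_eq_sum y _ (ha c)]
      simp only [mul_assoc]
      congr 1
      rw [← mul_assoc (e a ^ _), ← mul_pow])
  rw [det_numMatrix] at hnum
  have hden0 := hden.eventually_ne hV
  refine ⟨hden0.mono fun a ha h0 => ha (by rw [h0, zero_div]), ?_⟩
  have hdiv := hnum.div hden hV
  rw [mul_div_cancel_right₀ _ hV] at hdiv
  refine hdiv.congr' ?_
  filter_upwards [he0] with a ha
  exact div_div_div_cancel_right₀ (pow_ne_zero _ ha) _ _

theorem prod_pow_three_half (n : ℕ) :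
    ∏ i : Fin (2 * n), (3 : ℂ) ^ (i + 1 + (i + 1) / 2 : ℕ)
      = 3 ^ n ^ 2 * ∏ i : Fin (2 * n), (3 : ℂ) ^ (i + 1 : ℕ) := by
  rw [Fin.prod_univ_eq_prod_range (fun i => (3 : ℂ) ^ (i + 1 + (i + 1) / 2 : ℕ)),
    Fin.prod_univ_eq_prod_range (fun i => (3 : ℂ) ^ (i + 1 : ℕ))]
  induction n with
  | zero => simp
  | succ n ih =>
    have h1 : (2 * n + 1) / 2 = n := by omega
    have h2 : (2 * n + 1 + 1) / 2 = n + 1 := by omega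
    rw [show 2 * (n + 1) = 2 * n + 1 + 1 by ring, Finset.prod_range_succ, Finset.prod_range_succ,
      ih, Finset.prod_range_succ _ (2 * n + 1), Finset.prod_range_succ _ (2 * n), h1, h2]
    ring

theorem sdet_div_sdet {n : ℕ} (z : Fin (2 * n + 1) → ℂ) (hz : ∀ c, z c ≠ 0)
    (hl : z (Fin.last _) - (z (Fin.last _))⁻¹ ≠ 0)
    (hc : ∀ c : Fin (2 * n), (traceCoord (z c.castSucc) - traceCoord (z (Fin.last _))) *
      (z c.castSucc - (z c.castSucc)⁻¹) ≠ 0)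
    (hd : (Matrix.of fun i c : Fin (2 * n) => traceCoord (z c.castSucc) ^ (i : ℕ)).det ≠ 0) :
    sdet (2 * n + 1) (deltaE (2 * n + 1)) z ≠ 0 ∧
    sdet (2 * n + 1) (muE (2 * n + 1)) z / sdet (2 * n + 1) (deltaE (2 * n + 1)) z =
      3 ^ n ^ 2 * ((Matrix.of fun i c : Fin (2 * n) =>
        numFactor (traceCoord (z (Fin.last _))) (traceCoord (z c.castSucc)) i).det /
      (Matrix.of fun i c : Fin (2 * n) => traceCoord (z c.castSucc) ^ (i : ℕ)).det) := by
  rw [sdet_muE_eq z hz, sdet_deltaE_eq z hz, prod_pow_three_half]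
  have hs : ((Equiv.Perm.sign (Fin.revPerm : Equiv.Perm (Fin (2 * n + 1))) : ℤ) : ℂ) ≠ 0 :=
    Int.cast_ne_zero.2 (Units.ne_zero _)
  have h3 : ∏ i : Fin (2 * n), (3 : ℂ) ^ (i + 1 : ℕ) ≠ 0 :=
    Finset.prod_ne_zero_iff.2 fun i _ => pow_ne_zero _ (by norm_num)
  have hp := Finset.prod_ne_zero_iff.2 fun c (_ : c ∈ Finset.univ) => hc c
  refine ⟨mul_ne_zero (mul_ne_zero (mul_ne_zero hs hl) (mul_ne_zero h3 hp)) hd, ?_⟩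
  generalize (∏ c : Fin (2 * n), (traceCoord (z c.castSucc) - traceCoord (z (Fin.last _))) *
      (z c.castSucc - (z c.castSucc)⁻¹)) = P at hp
  generalize z (Fin.last _) - (z (Fin.last _))⁻¹ = L at hl
  generalize (Matrix.of fun i c : Fin (2 * n) =>
    numFactor (traceCoord (z (Fin.last _))) (traceCoord (z c.castSucc)) i).det = D
  field_simp

open Filter Topology in
theorem IsSymplecticExt.apply_ones_of_ne {n : ℕ} {X : (Fin (2 * n + 1) → ℂ) → ℂ}
    (hX : IsSymplecticExt (2 * n + 1) X) {v : ℂ} (hv : v ≠ 0) (hv2 : v ^ 2 ≠ 1) :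
    X (fun i => if i.1 < 2 * n then 1 else v) =
      3 ^ n ^ 2 * (Matrix.of fun i j : Fin n => gramEntry (traceCoord v) j i).det := by
  set Z : ℂ → Fin (2 * n + 1) → ℂ := fun ε i => if i.1 < 2 * n then 1 + ε * (i + 1) else v
    with hZ
  have hZlast (ε : ℂ) : Z ε (Fin.last _) = v := by simp [hZ]
  have hZcast (ε : ℂ) (c : Fin (2 * n)) : Z ε c.castSucc = 1 + ε * (c + 1) := by simp [hZ]
  have hlast : v - v⁻¹ ≠ 0 := by
    intro h
    apply hv2
    field_simp at h
    linear_combination h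
  have hy : traceCoord v ≠ 0 := by
    intro h
    unfold traceCoord at h
    field_simp at h
    have h1 : (v - 1) ^ 2 = 0 := by linear_combination h
    have h2 : v = 1 := by
      have := pow_eq_zero_iff (two_ne_zero) |>.1 h1
      linear_combination this
    exact hv2 (by rw [h2, one_pow])
  have hid : Tendsto (fun ε : ℂ => ε) (𝓝[≠] 0) (𝓝 0) :=
    tendsto_nhdsWithin_of_tendsto_nhds tendsto_id
  have hne : ∀ᶠ ε : ℂ in 𝓝[≠] 0, ε ≠ 0 := eventually_mem_nhdsWithin
  have hz1 (c : Fin (2 * n)) :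
      Tendsto (fun ε : ℂ => 1 + ε * ((c : ℂ) + 1)) (𝓝[≠] 0) (𝓝 1) := by
    simpa using (hid.mul_const ((c : ℂ) + 1)).const_add 1
  have hx (c : Fin (2 * n)) : (c : ℂ) + 1 ≠ 0 := Nat.cast_add_one_ne_zero (c : ℕ)
  have hzne : ∀ᶠ ε : ℂ in 𝓝[≠] 0, ∀ c : Fin (2 * n), 1 + ε * ((c : ℂ) + 1) ≠ 0 :=
    eventually_all.2 fun c => (hz1 c).eventually_ne one_ne_zero
  have hs (ε : ℂ) (c : Fin (2 * n)) (h : 1 + ε * ((c : ℂ) + 1) ≠ 0) :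
      traceCoord (Z ε c.castSucc)
        = ε ^ 2 * (((c : ℂ) + 1) ^ 2 / (3 * (1 + ε * ((c : ℂ) + 1)))) := by
    rw [hZcast, traceCoord]
    field_simp
    ring
  have hσ (c : Fin (2 * n)) : Tendsto (fun ε : ℂ =>
      ((c : ℂ) + 1) ^ 2 / (3 * (1 + ε * ((c : ℂ) + 1)))) (𝓝[≠] 0)
      (𝓝 (((c : ℂ) + 1) ^ 2 / 3)) := by
    have h := (tendsto_const_nhds (x := ((c : ℂ) + 1) ^ 2)).div ((hz1 c).const_mul 3) (by norm_num)
    rw [mul_one] at h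
    exact h
  have he : Tendsto (fun ε : ℂ => ε ^ 2) (𝓝[≠] 0) (𝓝 0) := by simpa using hid.pow 2
  obtain ⟨hdet, hlim⟩ := tendsto_det_numFactor_div (traceCoord v) (n := n) he
    (hne.mono fun ε h => pow_ne_zero 2 h)
    (σ := fun c ε => ((c : ℂ) + 1) ^ 2 / (3 * (1 + ε * ((c : ℂ) + 1))))
    (w₀ := fun c => ((c : ℂ) + 1) ^ 2 / 3) (by
      intro a b hab
      have h1 : ((a : ℂ) + 1) ^ 2 = ((b : ℂ) + 1) ^ 2 := by
        have : ((a : ℂ) + 1) ^ 2 / 3 = ((b : ℂ) + 1) ^ 2 / 3 := hab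
        linear_combination 3 * this
      have h2 : ((a : ℕ) + 1) ^ 2 = ((b : ℕ) + 1) ^ 2 := by exact_mod_cast h1
      have h3 := Nat.pow_left_injective two_ne_zero h2
      exact Fin.ext (by simpa using h3)) hσ
  have hX1 : Tendsto (fun ε => X (Z ε)) (𝓝[≠] 0)
      (𝓝 (X fun i => if i.1 < 2 * n then 1 else v)) := by
    refine (hX.1 _ ?_).tendsto.comp (tendsto_nhdsWithin_iff.2 ⟨?_, ?_⟩)
    · intro i
      dsimp only
      split_ifs
      · exact one_ne_zero
      · exact hv
    · refine tendsto_pi_nhds.2 fun i => ?_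
      by_cases hi : (i : ℕ) < 2 * n
      · simpa [hZ, hi] using hz1 ⟨i, hi⟩
      · simp [hZ, hi]
    · filter_upwards [hzne] with ε hε
      intro i
      by_cases hi : (i : ℕ) < 2 * n
      · simpa [hZ, hi] using hε ⟨i, hi⟩
      · simpa [hZ, hi] using hv
  refine tendsto_nhds_unique hX1 ((hlim.const_mul (3 ^ n ^ 2)).congr' ?_)
  have hsy : ∀ᶠ ε : ℂ in 𝓝[≠] 0, ∀ c : Fin (2 * n),
      ε ^ 2 * (((c : ℂ) + 1) ^ 2 / (3 * (1 + ε * ((c : ℂ) + 1)))) ≠ traceCoord v :=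
    eventually_all.2 fun c => by
      have h := he.mul (hσ c)
      rw [zero_mul] at h
      exact h.eventually_ne hy.symm
  have hz2 : ∀ᶠ ε : ℂ in 𝓝[≠] 0, ∀ c : Fin (2 * n), 1 + ε * ((c : ℂ) + 1) ≠ -1 :=
    eventually_all.2 fun c => (hz1 c).eventually_ne (by norm_num)
  filter_upwards [hne, hzne, hsy, hz2, hdet] with ε h0 hz hsy hz2 hdet
  have hZ0 (i : Fin (2 * n + 1)) : Z ε i ≠ 0 := by
    by_cases hi : (i : ℕ) < 2 * n
    · simpa [hZ, hi] using hz ⟨i, hi⟩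
    · simpa [hZ, hi] using hv
  have hs' (c : Fin (2 * n)) := hs ε c (hz c)
  obtain ⟨hδ, hratio⟩ := sdet_div_sdet (Z ε) hZ0 (by rwa [hZlast]) (fun c => by
    rw [hs', hZlast, hZcast]
    refine mul_ne_zero (sub_ne_zero.2 (hsy c)) fun h => ?_
    have h1 := mul_inv_cancel₀ (hz c)
    rw [← sub_eq_zero.1 h] at h1
    have h2 : ε * ((c : ℂ) + 1) * (1 + ε * ((c : ℂ) + 1) + 1) = 0 := by linear_combination h1
    rcases mul_eq_zero.1 h2 with h3 | h3
    · exact mul_ne_zero h0 (hx c) h3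
    · exact hz2 c (by linear_combination h3)) (by simpa only [hs'] using hdet)
  rw [hX.2 _ hZ0 hδ, hratio]
  simp only [hs', hZlast]

open Filter Topology in
theorem IsSymplecticExt.apply_ones {n : ℕ} {X : (Fin (2 * n + 1) → ℂ) → ℂ}
    (hX : IsSymplecticExt (2 * n + 1) X) {v : ℂ} (hv : v ≠ 0) :
    X (fun i => if i.1 < 2 * n then 1 else v) =
      3 ^ n ^ 2 * (Matrix.of fun i j : Fin n => gramEntry (traceCoord v) j i).det := by
  have hid : Tendsto (fun u : ℂ => u) (𝓝[≠] v) (𝓝 v) :=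
    tendsto_nhdsWithin_of_tendsto_nhds tendsto_id
  have hL : Tendsto (fun u => X (fun i => if i.1 < 2 * n then 1 else u)) (𝓝[≠] v)
      (𝓝 (X fun i => if i.1 < 2 * n then 1 else v)) := by
    refine (hX.1 _ ?_).tendsto.comp (tendsto_nhdsWithin_iff.2 ⟨?_, ?_⟩)
    · intro i
      dsimp only
      split_ifs
      · exact one_ne_zero
      · exact hv
    · refine tendsto_pi_nhds.2 fun i => ?_
      by_cases hi : (i : ℕ) < 2 * n
      · simp [hi]
      · simpa [hi] using hid
    · filter_upwards [hid.eventually_ne hv] with u hu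
      intro i
      by_cases hi : (i : ℕ) < 2 * n
      · simp [hi]
      · simpa [hi] using hu
  have hR : Tendsto (fun u => (3 : ℂ) ^ n ^ 2 *
      (Matrix.of fun i j : Fin n => gramEntry (traceCoord u) j i).det) (𝓝[≠] v)
      (𝓝 (3 ^ n ^ 2 * (Matrix.of fun i j : Fin n => gramEntry (traceCoord v) j i).det)) := by
    have hy : Tendsto traceCoord (𝓝[≠] v) (𝓝 (traceCoord v)) :=
      ((hid.add (hid.inv₀ hv)).sub_const 2).div_const 3
    have hc : Continuous fun y : ℂ => (Matrix.of fun i j : Fin n => gramEntry y j i).det := by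
      refine Continuous.matrix_det (continuous_matrix fun i j => ?_)
      simp only [Matrix.of_apply, gramEntry]
      fun_prop
    exact ((hc.tendsto _).comp hy).const_mul _
  refine tendsto_nhds_unique hL (hR.congr' ?_)
  have hfin : ∀ᶠ u : ℂ in 𝓝[≠] v, u ∉ ({1, -1} : Set ℂ) :=
    nhdsNE_le_cofinite v (Set.Finite.compl_mem_cofinite (Set.toFinite _))
  filter_upwards [hid.eventually_ne hv, hfin] with u hu hu1
  exact (hX.apply_ones_of_ne hu fun h => hu1 (by simpa using h)).symm

theorem zchoose_natCast (a : ℕ) (b : ℤ) : zchoose a b = intChoose a b := by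
  unfold zchoose intChoose
  by_cases h0 : 0 ≤ b
  · lift b to ℕ using h0
    by_cases h1 : b ≤ a
    · simp [h1]
    · simp [h1, Nat.choose_eq_zero_of_lt (not_le.1 h1)]
  · simp [h0]

theorem mul_traceCoord_of_primitive_cube_root {β q x : ℂ} (hβ : β ≠ 0) (hβ2 : β ^ 2 ≠ 1)
    (hq : q ^ 2 + q + 1 = 0) (hx : x = -((β * q - (β * q)⁻¹) / (β - β⁻¹))) :
    (1 - x + x ^ 2) * traceCoord ((β / q) ^ 2) = -(x - 1) ^ 2 := by
  have hq0 : q ≠ 0 := by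
    rintro rfl
    norm_num at hq
  have hb : β ^ 2 - 1 ≠ 0 := sub_ne_zero.2 hβ2
  have hb' : β - β⁻¹ ≠ 0 := by
    intro h
    field_simp at h
    exact hb (by simpa using h)
  have hq3 : q ^ 3 = 1 := by linear_combination (q - 1) * hq
  have hx1 : x * (β ^ 2 - 1) = q ^ 2 - β ^ 2 * q := by
    have h1 : x * (β - β⁻¹) = -(β * q - (β * q)⁻¹) := by
      rw [hx]
      field_simp
    field_simp at h1
    linear_combination q ^ 2 * h1 - (x * (β ^ 2 - 1) + β ^ 2 * q) * hq3
  have hv : (β / q) ^ 2 = β ^ 2 * q := by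
    field_simp
    linear_combination -hq3
  have hT : traceCoord (β ^ 2 * q) = (β ^ 2 * q - 1) ^ 2 / (3 * (β ^ 2 * q)) := by
    unfold traceCoord
    field_simp
    ring
  have hxx : (1 - x + x ^ 2) * (β ^ 2 - 1) ^ 2 = -3 * β ^ 2 := by
    linear_combination (x * (β ^ 2 - 1) + (q ^ 2 - β ^ 2 * q) - (β ^ 2 - 1)) * hx1 +
      (β ^ 4 + (1 - q + q ^ 2) - β ^ 2 - 2 * β ^ 2 * (q - 1)) * hq
  have hx2 : (x - 1) * (β ^ 2 - 1) = q * (β ^ 2 * q - 1) := by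
    linear_combination hx1 + (1 - β ^ 2) * hq
  rw [hv, hT, mul_div_assoc', div_eq_iff (by simp [hβ, hq0])]
  apply mul_right_cancel₀ (pow_ne_zero 2 hb)
  linear_combination (β ^ 2 * q - 1) ^ 2 * hxx + 3 * β ^ 2 * q *
    ((x - 1) * (β ^ 2 - 1) + q * (β ^ 2 * q - 1)) * hx2 + 3 * β ^ 2 * (β ^ 2 * q - 1) ^ 2 * hq3

/-- **Proposition 3.3.** Determinant formula for the odd-size symplectic
character specialised at `(1, …, 1, (β/q)²)` with `q = e^{2πi/3}`. -/
theorem sympl_char_det_odd (n : ℕ) (β : ℂ) (hβ : β ≠ 0) (hβ2 : β^2 ≠ 1)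
    (q : ℂ) (hq : q = Complex.exp (2 * Real.pi * Complex.I / 3))
    (x : ℂ) (hx : x = -((β*q - (β*q)⁻¹) / (β - β⁻¹)))
    (hxx : 1 - x + x^2 ≠ 0)
    (X : (Fin (2*n+1) → ℂ) → ℂ) (hX : IsSymplecticExt (2*n+1) X) :
    X (fun i => if i.1 < 2*n then 1 else (β/q)^2)
      = 3^(n^2) / (1 - x + x^2)^n *
        Matrix.det (Matrix.of fun i j : Fin n =>
          (x-1)^2 * (zchoose ((i.1 : ℤ) + j.1) (2*(j.1 : ℤ) - i.1) : ℂ)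
          + x * (zchoose ((i.1 : ℤ) + j.1 + 2) (2*(j.1 : ℤ) - i.1 + 1) : ℂ)) := by
  have hprim : IsPrimitiveRoot q 3 := by
    rw [hq]
    exact_mod_cast Complex.isPrimitiveRoot_exp 3 (by norm_num)
  have hq1 : q ^ 2 + q + 1 = 0 := by
    have h := hprim.geom_sum_eq_zero (by norm_num)
    simp only [Finset.sum_range_succ, Finset.sum_range_zero] at h
    linear_combination h
  have hy := mul_traceCoord_of_primitive_cube_root hβ hβ2 hq1 hx
  rw [hX.apply_ones (pow_ne_zero 2 (div_ne_zero hβ (hprim.ne_zero (by norm_num))))]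
  set y := traceCoord ((β / q) ^ 2)
  have hmat : (Matrix.of fun i j : Fin n =>
      (x-1)^2 * (zchoose ((i.1 : ℤ) + j.1) (2*(j.1 : ℤ) - i.1) : ℂ)
        + x * (zchoose ((i.1 : ℤ) + j.1 + 2) (2*(j.1 : ℤ) - i.1 + 1) : ℂ)) =
      (1 - x + x ^ 2) • Matrix.of fun i j : Fin n => gramEntry y j i := by
    ext i j
    have h1 := zchoose_natCast (i + j) (2 * (j : ℤ) - i)
    have h2 := zchoose_natCast (i + j + 2) (2 * (j : ℤ) - i + 1)
    push_cast at h1 h2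
    simp only [Matrix.of_apply, Matrix.smul_apply, smul_eq_mul, gramEntry, h1, h2, Int.cast_natCast]
    generalize ((intChoose _ _ : ℕ) : ℂ) = A
    generalize ((intChoose _ _ : ℕ) : ℂ) = B
    linear_combination (A - B) * hy
  rw [hmat, Matrix.det_smul, Fintype.card_fin]
  field_simp

end
end

section
/- Let n ≥ 1 and let X be an extension of the symplectic character ratio of size 2n. Define g : ℂ∖{0} → ℂ by g(z) = z^{−2n} (z−1)^{4n−1} (z+1) · X(1, …, 1, z), where the first 2n−1 arguments of X equal 1. Then g is twice differentiable on ℂ∖{0}, and for every z with z ≠ 0 and z³ ≠ 1 one has z · d/dz( z·g′(z) ) + 3(2n−1) · ((1+z³)/(1−z³)) · z·g′(z) + (3n−1)(3n−2) · g(z) = 0. -/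
noncomputable section

open Polynomial Filter Topology

/-- The quotient `(z ^ (k + 1) - z⁻¹ ^ (k + 1)) / (z - z⁻¹)` is a monic polynomial of degree `k`
in `z + z⁻¹`. -/
lemma exists_monic_eval_add_inv (k : ℕ) : ∃ p : ℂ[X], p.Monic ∧ p.natDegree = k ∧
    ∀ z : ℂ, z ≠ 0 → z ^ (k + 1) - z⁻¹ ^ (k + 1) = (z - z⁻¹) * p.eval (z + z⁻¹) := by
  suffices h : ∀ k : ℕ, ∃ p q : ℂ[X], (p.Monic ∧ p.natDegree = k ∧
      ∀ z : ℂ, z ≠ 0 → z ^ (k + 1) - z⁻¹ ^ (k + 1) = (z - z⁻¹) * p.eval (z + z⁻¹)) ∧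
      (q.Monic ∧ q.natDegree = k + 1 ∧
      ∀ z : ℂ, z ≠ 0 → z ^ (k + 2) - z⁻¹ ^ (k + 2) = (z - z⁻¹) * q.eval (z + z⁻¹)) by
    obtain ⟨p, _, hp, _⟩ := h k
    exact ⟨p, hp⟩
  intro k
  induction k with
  | zero =>
    refine ⟨1, X, ⟨monic_one, natDegree_one, fun z _ => by simp⟩,
      ⟨monic_X, natDegree_X, fun z _ => by simp; ring⟩⟩
  | succ k ih =>
    obtain ⟨p, q, ⟨hp, hpd, hpe⟩, hq, hqd, hqe⟩ := ih
    have hdeg : (X * q).natDegree = k + 2 := by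
      rw [natDegree_X_mul hq.ne_zero, hqd]
    have hlt : p.degree < (X * q).degree := by
      apply degree_lt_degree
      omega
    refine ⟨q, X * q - p, ⟨hq, hqd, hqe⟩, (monic_X.mul hq).sub_of_left hlt, ?_, fun z hz => ?_⟩
    · rw [natDegree_sub_eq_left_of_natDegree_lt (by omega), hdeg]
    · have h1 := hpe z hz
      have h2 := hqe z hz
      have h3 : z * z⁻¹ = 1 := mul_inv_cancel₀ hz
      rw [eval_sub, eval_mul, eval_X, mul_sub, mul_left_comm, ← h1, ← h2]
      generalize z⁻¹ = w at *
      linear_combination (z ^ (k + 1) - w ^ (k + 1)) * (-h3)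

lemma det_vandermonde_snoc {M : ℕ} (v : Fin M → ℂ) (x : ℂ) :
    (Matrix.vandermonde (Fin.snoc v x : Fin (M + 1) → ℂ)).det =
      (Matrix.vandermonde v).det * ∏ j, (x - v j) := by
  have key : ∀ (K : ℕ) (w : Fin K → ℂ), (Matrix.vandermonde w).det =
      ∏ i, ∏ j, if i < j then w j - w i else 1 := by
    intro K w
    rw [Matrix.det_vandermonde]
    refine Finset.prod_congr rfl fun i _ => ?_
    rw [← Finset.prod_filter]
    exact Finset.prod_congr (by ext; simp) fun _ _ => rfl
  rw [key, key, Fin.prod_univ_castSucc]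
  simp only [Fin.prod_univ_castSucc, Fin.snoc_castSucc, Fin.snoc_last, Fin.castSucc_lt_castSucc_iff,
    Fin.castSucc_lt_last, if_true, Finset.prod_mul_distrib]
  simp [Fin.not_lt.2 (Fin.le_last _)]

/-- The type `C` Weyl denominator formula, up to sign. -/
lemma exists_sdet_deltaE (N : ℕ) : ∃ σ : ℂ, σ ≠ 0 ∧ ∀ z : Fin N → ℂ, (∀ i, z i ≠ 0) →
    sdet N (deltaE N) z =
      σ * (∏ j, (z j - (z j)⁻¹)) * (Matrix.vandermonde fun j => z j + (z j)⁻¹).det := by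
  choose p hp hpd hpe using exists_monic_eval_add_inv
  refine ⟨(Equiv.Perm.sign (Fin.revPerm : Equiv.Perm (Fin N)) : ℤ), by simp, fun z hz => ?_⟩
  rw [Matrix.det_eval_matrixOfPolynomials_eq_det_vandermonde _ (fun i : Fin N => p i)
    (fun i => hpd i) (fun i => hp i), ← Matrix.det_transpose, mul_assoc, ← Matrix.det_mul_row,
    ← Matrix.det_permute, sdet]
  congr 1
  ext i j
  have h : N - (i : ℕ) = ((Fin.rev i : Fin N) : ℕ) + 1 := by
    rw [Fin.val_rev]; omega
  simp only [Matrix.of_apply, Matrix.submatrix_apply, Matrix.transpose_apply, id, deltaE,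
    Fin.revPerm_apply]
  rw [h, ← hpe _ _ (hz j), zpow_neg, zpow_natCast, inv_pow]

/-- Expansion of `sdet` along the column of the last variable. -/
lemma sdet_snoc {M : ℕ} (e : Fin (M + 1) → ℕ) (v : Fin M → ℂ) :
    ∃ b : Fin (M + 1) → ℂ, ∀ z : ℂ, sdet (M + 1) e (Fin.snoc v z) =
      ∑ i, b i * (z ^ (e i : ℤ) - z ^ (-(e i : ℤ))) := by
  refine ⟨fun i => (-1) ^ (i + M : ℕ) * Matrix.det (Matrix.of fun k j : Fin M =>
    v j ^ (e (i.succAbove k) : ℤ) - v j ^ (-(e (i.succAbove k) : ℤ))), fun z => ?_⟩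
  rw [sdet, Matrix.det_succ_column _ (Fin.last M)]
  refine Finset.sum_congr rfl fun i _ => ?_
  have : (Matrix.of fun i j : Fin (M + 1) => (Fin.snoc v z : Fin (M + 1) → ℂ) j ^ (e i : ℤ) -
      (Fin.snoc v z : Fin (M + 1) → ℂ) j ^ (-(e i : ℤ))).submatrix i.succAbove
        (Fin.last M).succAbove = Matrix.of fun k j : Fin M =>
    v j ^ (e (i.succAbove k) : ℤ) - v j ^ (-(e (i.succAbove k) : ℤ)) := by
    ext k j
    simp
  rw [this]
  simp only [Matrix.of_apply, Fin.snoc_last, Fin.val_last]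
  ring

lemma add_inv_ne_add_inv {z w : ℂ} (hz : z ≠ 0) (hw : w ≠ 0) (h : z ≠ w) (h' : z * w ≠ 1) :
    z + z⁻¹ ≠ w + w⁻¹ := by
  intro H
  field_simp at H
  have : (z - w) * (z * w - 1) = 0 := by linear_combination H
  rcases mul_eq_zero.1 this with h1 | h1
  · exact h (sub_eq_zero.1 h1)
  · exact h' (sub_eq_zero.1 h1)

/-- A continuous extension, multiplied by the last-variable part of the Weyl denominator and
evaluated at `(1, …, 1, z)`, is a combination of the functions `z ^ μ_i - z ^ (-μ_i)`. -/
lemma IsSymplecticExt.exists_eq_sum {N M : ℕ} (hN : N = M + 1) {X : (Fin N → ℂ) → ℂ}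
    (hX : IsSymplecticExt N X) : ∃ c : Fin N → ℂ, ∀ z : ℂ, z ≠ 0 →
      (z - z⁻¹) * (z + z⁻¹ - 2) ^ M * X (fun i => if i.1 < M then 1 else z) =
        ∑ i, c i * (z ^ (muE N i : ℤ) - z ^ (-(muE N i : ℤ))) := by
  subst hN
  obtain ⟨σ, hσ, hδ⟩ := exists_sdet_deltaE (M + 1)
  set f : Fin (M + 1) → ℂ → ℂ := fun i z => z ^ (muE (M + 1) i : ℤ) - z ^ (-(muE (M + 1) i : ℤ))
  set L : ℂ → ℂ := fun z =>
    (z - z⁻¹) * (z + z⁻¹ - 2) ^ M * X (fun i => if i.1 < M then 1 else z)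
  suffices hL : L ∈ Submodule.span ℂ (Set.range f) by
    obtain ⟨c, hc⟩ := (Submodule.mem_span_range_iff_exists_fun ℂ).1 hL
    refine ⟨c, fun z _ => ?_⟩
    have := congrFun hc z
    simpa [f] using this.symm
  have : FiniteDimensional ℂ (Submodule.span ℂ (Set.range f)) :=
    FiniteDimensional.span_of_finite ℂ (Set.finite_range f)
  set a : ℕ → Fin M → ℝ := fun m j => 1 + ((j : ℕ) + 1 : ℝ) * (1 / ((m : ℝ) + 1)) with ha
  have ha1 : ∀ m j, 1 < a m j := fun m j => by
    simp only [ha]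
    have : 0 < ((j : ℕ) + 1 : ℝ) * (1 / ((m : ℝ) + 1)) := by positivity
    linarith
  have hainj : ∀ m, Function.Injective (a m) := fun m i j hij => by
    simp only [ha] at hij
    have : (1 / ((m : ℝ) + 1)) ≠ 0 := by positivity
    have h2 := mul_right_cancel₀ this (add_left_cancel hij)
    exact Fin.ext (by exact_mod_cast add_right_cancel h2)
  have ha0 : ∀ m j, (a m j : ℂ) ≠ 0 := fun m j => by
    exact_mod_cast (zero_lt_one.trans (ha1 m j)).ne'
  have hlim : ∀ j, Tendsto (fun m => (a m j : ℂ)) atTop (𝓝 1) := fun j => by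
    have h1 : Tendsto (fun m => a m j) atTop (𝓝 (1 + ((j : ℕ) + 1 : ℝ) * 0)) :=
      tendsto_const_nhds.add (tendsto_one_div_add_atTop_nhds_zero_nat.const_mul _)
    have h2 := (Complex.continuous_ofReal.tendsto _).comp h1
    simpa [Function.comp_def] using h2
  choose b hb using fun m => sdet_snoc (muE (M + 1)) (fun j => (a m j : ℂ))
  set D : ℕ → ℂ := fun m => σ * (∏ j, ((a m j : ℂ) - (a m j : ℂ)⁻¹)) *
    (Matrix.vandermonde fun j => (a m j : ℂ) + (a m j : ℂ)⁻¹).det with hD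
  have hmul : ∀ m i j, (a m i : ℂ) * (a m j : ℂ) ≠ 1 := fun m i j => by
    have : a m i * a m j ≠ 1 := by nlinarith [ha1 m i, ha1 m j]
    exact_mod_cast this
  have hD0 : ∀ m, D m ≠ 0 := fun m => by
    refine mul_ne_zero (mul_ne_zero hσ (Finset.prod_ne_zero_iff.2 fun j _ h => ?_))
      (Matrix.det_vandermonde_ne_zero_iff.2 fun i j hij => ?_)
    · apply hmul m j j
      nth_rewrite 1 [sub_eq_zero.1 h]
      exact inv_mul_cancel₀ (ha0 m j)
    · by_contra hne
      refine add_inv_ne_add_inv (ha0 m i) (ha0 m j) (fun h => hne ?_) (hmul m i j) hij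
      exact hainj m (Complex.ofReal_injective h)
  refine (Submodule.span ℂ (Set.range f)).closed_of_finiteDimensional.mem_of_tendsto
    (f := fun m : ℕ => ∑ i, (b m i / D m) • f i) (b := atTop) ?_
    (Eventually.of_forall fun m => Submodule.sum_mem _ fun i _ =>
      Submodule.smul_mem _ _ (Submodule.subset_span ⟨i, rfl⟩))
  refine tendsto_pi_nhds.2 fun z => ?_
  by_cases hzz : z = z⁻¹
  · have h1 : L z = 0 := by simp [L, ← hzz]
    have h2 : ∀ i, f i z = 0 := fun i => by
      simp only [f]
      rw [zpow_neg, ← inv_zpow, ← hzz, sub_self]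
    simp [h1, h2]
  have hz0 : z ≠ 0 := fun h => hzz (by simp [h])
  have hz1 : z ≠ 1 := fun h => hzz (by simp [h])
  have hz1' : z⁻¹ ≠ 1 := fun h => hz1 (inv_eq_one.1 h)
  have hpt0 : ∀ m i, (Fin.snoc (fun j => (a m j : ℂ)) z : Fin (M + 1) → ℂ) i ≠ 0 := fun m i => by
    refine Fin.lastCases ?_ (fun j => ?_) i
    · simpa using hz0
    · simpa using (zero_lt_one.trans (ha1 m j)).ne'
  have hev : ∀ᶠ m in atTop, ∀ j, (a m j : ℂ) ≠ z ∧ (a m j : ℂ) ≠ z⁻¹ :=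
    eventually_all.2 fun j =>
      ((hlim j).eventually_ne hz1.symm).and ((hlim j).eventually_ne hz1'.symm)
  have hW : Tendsto (fun m => (z - z⁻¹) * ∏ j, (z + z⁻¹ - ((a m j : ℂ) + (a m j : ℂ)⁻¹))) atTop
      (𝓝 ((z - z⁻¹) * (z + z⁻¹ - 2) ^ M)) := by
    refine Tendsto.const_mul _ ?_
    have h1 : Tendsto (fun m => ∏ j, (z + z⁻¹ - ((a m j : ℂ) + (a m j : ℂ)⁻¹))) atTop
        (𝓝 (∏ _j : Fin M, (z + z⁻¹ - (1 + 1⁻¹)))) :=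
      tendsto_finsetProd _ fun j _ => tendsto_const_nhds.sub
        ((hlim j).add ((hlim j).inv₀ one_ne_zero))
    rw [show (1 : ℂ) + 1⁻¹ = 2 by norm_num] at h1
    simpa using h1
  have hXlim : Tendsto (fun m => X (Fin.snoc (fun j => (a m j : ℂ)) z)) atTop
      (𝓝 (X (fun i => if i.1 < M then 1 else z))) := by
    refine (hX.1 (fun i => if i.1 < M then 1 else z) fun i => ?_).tendsto.comp
      (tendsto_nhdsWithin_iff.2 ⟨tendsto_pi_nhds.2 fun i => ?_, Eventually.of_forall fun m => hpt0 m⟩)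
    · dsimp only
      split_ifs
      exacts [one_ne_zero, hz0]
    · refine Fin.lastCases ?_ (fun j => ?_) i
      · simp
      · simpa using hlim j
  refine (hW.mul hXlim).congr' ?_
  filter_upwards [hev] with m hm
  have hden : sdet (M + 1) (deltaE (M + 1)) (Fin.snoc (fun j => (a m j : ℂ)) z) =
      D m * ((z - z⁻¹) * ∏ j, (z + z⁻¹ - ((a m j : ℂ) + (a m j : ℂ)⁻¹))) := by
    rw [hδ _ (hpt0 m)]
    have : (fun j => (Fin.snoc (fun j => (a m j : ℂ)) z : Fin (M + 1) → ℂ) j +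
        ((Fin.snoc (fun j => (a m j : ℂ)) z : Fin (M + 1) → ℂ) j)⁻¹) =
        Fin.snoc (fun j => (a m j : ℂ) + (a m j : ℂ)⁻¹) (z + z⁻¹) := by
      funext i
      refine Fin.lastCases ?_ (fun j => ?_) i <;> simp
    rw [this, det_vandermonde_snoc, Fin.prod_univ_castSucc]
    simp only [Fin.snoc_castSucc, Fin.snoc_last, hD]
    ring
  have hW0 : (z - z⁻¹) * ∏ j, (z + z⁻¹ - ((a m j : ℂ) + (a m j : ℂ)⁻¹)) ≠ 0 := by
    refine mul_ne_zero (sub_ne_zero.2 hzz) (Finset.prod_ne_zero_iff.2 fun j _ => sub_ne_zero.2 ?_)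
    refine add_inv_ne_add_inv hz0 (ha0 m j) (hm j).1.symm fun h => (hm j).2 ?_
    exact eq_inv_of_mul_eq_one_right h
  have hXeq := hX.2 _ (hpt0 m) (by rw [hden]; exact mul_ne_zero (hD0 m) hW0)
  rw [hXeq, hden, hb, Finset.sum_apply]
  simp only [Pi.smul_apply, smul_eq_mul, div_mul_eq_mul_div, ← Finset.sum_div, f]
  rw [mul_div_assoc', mul_comm (D m), mul_div_mul_left _ _ hW0]

/-- The operator `z d/dz - c` on polynomials. -/
def shiftedEuler (c : ℂ) (P : ℂ[X]) : ℂ[X] := X * derivative P - C c * P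

lemma coeff_shiftedEuler (c : ℂ) (P : ℂ[X]) (i : ℕ) :
    (shiftedEuler c P).coeff i = (i - c) * P.coeff i := by
  rw [shiftedEuler, coeff_sub, coeff_C_mul]
  rcases i with _ | i
  · simp
  · rw [coeff_X_mul, coeff_derivative]
    push_cast
    ring

lemma pow_dvd_shiftedEuler {m : ℕ} {P : ℂ[X]} (c : ℂ) (h : (X - C 1) ^ (m + 1) ∣ P) :
    (X - C 1) ^ m ∣ shiftedEuler c P :=
  dvd_sub ((pow_sub_one_dvd_derivative_of_pow_dvd h).mul_left _)
    (((pow_dvd_pow _ m.le_succ).trans h).mul_left _)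

/-- A nonzero polynomial with at most `m` terms cannot vanish to order `m` at `1`. -/
lemma eq_zero_of_card_support_le {m : ℕ} {P : ℂ[X]} (hP : P.support.card ≤ m)
    (h : (X - C 1) ^ m ∣ P) : P = 0 := by
  induction m generalizing P with
  | zero => simpa using hP
  | succ m ih =>
    by_contra hne
    obtain ⟨k, hk⟩ := nonempty_support_iff.2 hne
    have hsub : (shiftedEuler k P).support ⊆ P.support.erase k := fun i hi => by
      rw [mem_support_iff, coeff_shiftedEuler] at hi
      rw [Finset.mem_erase, mem_support_iff]
      exact ⟨fun hik => hi (by simp [hik]), right_ne_zero_of_mul hi⟩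
    have h0 : shiftedEuler k P = 0 := by
      refine ih ?_ (pow_dvd_shiftedEuler _ h)
      have := Finset.card_le_card hsub
      rw [Finset.card_erase_of_mem hk] at this
      omega
    have hmono : P = C (P.coeff k) * X ^ k := by
      ext i
      rw [coeff_C_mul_X_pow]
      split_ifs with hik
      · rw [hik]
      · have := coeff_shiftedEuler k P i
        rw [h0, coeff_zero] at this
        refine (mul_eq_zero.1 this.symm).resolve_left (sub_ne_zero.2 ?_)
        exact_mod_cast hik
    have hroot : P.eval 1 = 0 :=
      dvd_iff_isRoot.1 ((dvd_pow_self _ m.succ_ne_zero).trans h)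
    rw [hmono] at hroot
    exact mem_support_iff.1 hk (by simpa using hroot)

/-- A polynomial whose exponents are at most `6 n - 2` and not congruent to `2` modulo `3`, and
which vanishes to order `4 n - 1` at `1`, satisfies a second order differential equation. -/
lemma shiftedEuler_ode {n : ℕ} (hn : 1 ≤ n) {P : ℂ[X]}
    (hP : ∀ i, P.coeff i ≠ 0 → i % 3 ≠ 2 ∧ i ≤ 6 * n - 2) (h : (X - C 1) ^ (4 * n - 1) ∣ P) :
    (1 - X ^ 3) * shiftedEuler (3 * n - 1) (shiftedEuler (3 * n - 1) P) +
      C (3 * (2 * n - 1) : ℂ) * ((1 + X ^ 3) * shiftedEuler (3 * n - 1) P) +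
      C ((3 * n - 1) * (3 * n - 2) : ℂ) * ((1 - X ^ 3) * P) = 0 := by
  have hP' : ∀ i, i % 3 = 2 ∨ 6 * n - 2 < i → P.coeff i = 0 := fun i hi => by
    by_contra hne
    have := hP i hne
    omega
  obtain ⟨m, hm⟩ : ∃ m, 4 * n - 1 = m + 1 + 1 := ⟨4 * n - 3, by omega⟩
  rw [hm] at h
  refine eq_zero_of_card_support_le (m := m + 1) ?_ ?_
  · refine (Finset.card_le_card (t := (Finset.range (m + 1)).image
      fun j => 3 + 3 * (j / 2) + j % 2) fun i hi => ?_).trans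
      (Finset.card_image_le.trans (Finset.card_range _).le)
    suffices hi' : i % 3 ≠ 2 ∧ 3 ≤ i ∧ i ≤ 6 * n - 2 by
      refine Finset.mem_image.2 ⟨2 * ((i - 3) / 3) + i % 3, Finset.mem_range.2 ?_, ?_⟩ <;> omega
    by_contra hcon
    refine mem_support_iff.1 hi ?_
    simp only [sub_mul, add_mul, one_mul, coeff_add, coeff_sub, coeff_C_mul, coeff_X_pow_mul',
      coeff_shiftedEuler]
    have hcases : i = 0 ∨ i = 1 ∨ i = 6 * n ∨ i = 6 * n + 1 ∨ 3 ≤ i ∧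
        (i % 3 = 2 ∨ 6 * n + 1 < i) ∨ i = 2 := by omega
    rcases hcases with rfl | rfl | rfl | rfl | ⟨h3, h4⟩ | rfl
    · simp
      ring
    · simp
      ring
    · rw [if_pos (by omega), if_pos (by omega), if_pos (by omega), hP' (6 * n) (by omega),
        Nat.cast_sub (by omega)]
      push_cast
      ring
    · rw [if_pos (by omega), if_pos (by omega), if_pos (by omega), hP' (6 * n + 1) (by omega),
        Nat.cast_sub (by omega)]
      push_cast
      ring
    · rw [hP' i (by omega), hP' (i - 3) (by omega)]
      simp
    · simp [hP' 2 (by simp)]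
  · have h1 := pow_dvd_shiftedEuler (3 * n - 1 : ℂ) h
    have h2 := pow_dvd_shiftedEuler (3 * n - 1 : ℂ) h1
    have h3 : (X - C 1 : ℂ[X]) ∣ 1 - X ^ 3 := dvd_iff_isRoot.2 (by simp)
    refine dvd_add (dvd_add ?_ ((h1.mul_left _).mul_left _))
      ((((pow_dvd_pow _ (m + 1).le_succ).trans h).mul_left _).mul_left _)
    rw [pow_succ']
    exact mul_dvd_mul h3 h2

/-- If a polynomial function equals `(z - 1) ^ m` times a function continuous at `1`, then
`(X - 1) ^ m` divides the polynomial. -/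
lemma pow_dvd_of_eval_eq {m : ℕ} {P : ℂ[X]} {k : ℂ → ℂ} (hk : ContinuousAt k 1)
    (h : ∀ᶠ z in 𝓝 (1 : ℂ), P.eval z = (z - 1) ^ m * k z) : (X - C 1) ^ m ∣ P := by
  by_cases hP : P = 0
  · simp [hP]
  rw [← le_rootMultiplicity_iff hP]
  by_contra! hlt
  obtain ⟨Q, hQ, hQ1⟩ := exists_eq_pow_rootMultiplicity_mul_and_not_dvd P hP 1
  set r := rootMultiplicity 1 P
  refine hQ1 (dvd_iff_isRoot.2 ?_)
  have hlim : Tendsto (fun z => (z - 1) ^ (m - r) * k z) (𝓝[≠] 1) (𝓝 0) := by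
    have : ContinuousAt (fun z : ℂ => (z - 1) ^ (m - r) * k z) 1 :=
      (by fun_prop : ContinuousAt (fun z : ℂ => (z - 1) ^ (m - r)) 1).mul hk
    have h1 := this.tendsto.mono_left (nhdsWithin_le_nhds (s := {1}ᶜ))
    simpa [zero_pow (Nat.sub_ne_zero_of_lt hlt)] using h1
  have hlim' : Tendsto (fun z => Q.eval z) (𝓝[≠] 1) (𝓝 (Q.eval 1)) :=
    Q.continuous.continuousAt.tendsto.mono_left nhdsWithin_le_nhds
  refine tendsto_nhds_unique hlim' (hlim.congr' ?_)
  filter_upwards [h.filter_mono nhdsWithin_le_nhds, self_mem_nhdsWithin] with z hz hz1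
  have hz1' : (z - 1) ^ r ≠ 0 := pow_ne_zero _ (sub_ne_zero.2 hz1)
  rw [hQ, eval_mul, eval_pow, eval_sub, eval_X, eval_C, ← Nat.add_sub_of_le hlt.le, pow_add,
    mul_assoc] at hz
  exact (mul_left_cancel₀ hz1' hz).symm

lemma hasDerivAt_zpow_mul_eval (P : ℂ[X]) (a : ℤ) {z : ℂ} (hz : z ≠ 0) :
    HasDerivAt (fun w => w ^ (-a) * P.eval w) (z ^ (-a - 1) * (shiftedEuler a P).eval z) z := by
  refine ((hasDerivAt_zpow (-a) z (Or.inl hz)).mul (P.hasDerivAt z)).congr_deriv ?_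
  simp only [shiftedEuler, eval_sub, eval_mul, eval_X, eval_C]
  rw [zpow_sub_one₀ hz]
  push_cast
  field_simp
  ring

/-- **Proposition 4.3 (even size).** The function
`g(z) = z^{−2n} (z−1)^{4n−1} (z+1) χ_{2n}(1,…,1,z)` is twice differentiable away
from `0` and satisfies the ODE
`z (z g′)′ + 3(2n−1) (1+z³)/(1−z³) z g′ + (3n−1)(3n−2) g = 0` for `z³ ≠ 1`. -/
theorem ode_even (n : ℕ) (hn : 1 ≤ n)
    (X : (Fin (2*n) → ℂ) → ℂ) (hX : IsSymplecticExt (2*n) X)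
    (g : ℂ → ℂ)
    (hg : ∀ z : ℂ, g z = z ^ (-(2*(n:ℤ))) * (z-1)^(4*n-1) * (z+1) *
        X (fun i => if i.1 < 2*n - 1 then 1 else z)) :
    (∀ z : ℂ, z ≠ 0 → DifferentiableAt ℂ g z ∧ DifferentiableAt ℂ (deriv g) z)
    ∧ ∀ z : ℂ, z ≠ 0 → z^3 ≠ 1 →
        z * deriv (fun w => w * deriv g w) z
        + 3*(2*(n:ℂ) - 1) * ((1 + z^3)/(1 - z^3)) * (z * deriv g z)
        + (3*(n:ℂ) - 1) * (3*(n:ℂ) - 2) * g z = 0 := by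
  have hsq : ∀ z : ℂ, z ≠ 0 → g z = (z - z⁻¹) * (z + z⁻¹ - 2) ^ (2 * n - 1) *
      X (fun i => if i.1 < 2 * n - 1 then 1 else z) := fun z hz => by
    have h1 : z - z⁻¹ = z⁻¹ * ((z - 1) * (z + 1)) := by field_simp; ring
    have h2 : z + z⁻¹ - 2 = z⁻¹ * (z - 1) ^ 2 := by field_simp; ring
    rw [hg, h1, h2, mul_pow, ← pow_mul, show 4 * n - 1 = 2 * (2 * n - 1) + 1 by omega, pow_succ,
      zpow_neg, ← inv_zpow, show (2 * (n : ℤ)) = ((2 * n - 1 + 1 : ℕ) : ℤ) by omega,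
      zpow_natCast, pow_succ]
    ring
  obtain ⟨c, hc⟩ := hX.exists_eq_sum (M := 2 * n - 1) (by omega)
  have hμ : ∀ i : Fin (2 * n), 0 < muE (2 * n) i ∧ muE (2 * n) i ≤ 3 * n - 1 ∧
      muE (2 * n) i % 3 ≠ 0 := fun i => by
    have := i.2
    simp only [muE]
    omega
  set P : ℂ[X] := ∑ i, C (c i) *
    (Polynomial.X ^ (3 * n - 1 + muE (2 * n) i) - Polynomial.X ^ (3 * n - 1 - muE (2 * n) i)) with hPdef
  have hgP : ∀ z : ℂ, z ≠ 0 → g z = z ^ (-(3 * n - 1 : ℤ)) * P.eval z := fun z hz => by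
    rw [hsq z hz, hc z hz, hPdef, eval_finsetSum, Finset.mul_sum]
    refine Finset.sum_congr rfl fun i _ => ?_
    have hi := hμ i
    simp only [eval_mul, eval_sub, eval_pow, eval_X, eval_C]
    rw [mul_left_comm, mul_sub (z ^ (-(3 * n - 1 : ℤ))), ← zpow_natCast z (3 * n - 1 + _),
      ← zpow_natCast z (3 * n - 1 - _), ← zpow_add₀ hz, ← zpow_add₀ hz]
    congr <;> omega
  have hsupp : ∀ i, P.coeff i ≠ 0 → i % 3 ≠ 2 ∧ i ≤ 6 * n - 2 := fun i hi => by
    rw [hPdef, finsetSum_coeff] at hi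
    obtain ⟨j, -, hj⟩ := Finset.exists_ne_zero_of_sum_ne_zero hi
    have hμj := hμ j
    rw [coeff_C_mul, coeff_sub, coeff_X_pow, coeff_X_pow] at hj
    have hij : i = 3 * n - 1 + muE (2 * n) j ∨ i = 3 * n - 1 - muE (2 * n) j := by
      by_contra! hcon
      simp [hcon.1, hcon.2] at hj
    omega
  have hdvd : (Polynomial.X - C 1) ^ (4 * n - 1) ∣ P := by
    refine pow_dvd_of_eval_eq (k := fun z => z ^ (3 * n - 1 : ℤ) * (z ^ (-(2 * (n : ℤ))) * (z + 1) *
      X (fun i => if i.1 < 2 * n - 1 then 1 else z))) ?_ ?_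
    · have hopen : IsOpen {z : Fin (2 * n) → ℂ | ∀ i, z i ≠ 0} := by
        simp only [Set.ofPred_forall]
        exact isOpen_iInter_of_finite fun i => isOpen_ne_fun (continuous_apply i) continuous_const
      have hXc : ContinuousAt (fun z : ℂ => X (fun i => if i.1 < 2 * n - 1 then 1 else z)) 1 := by
        refine ContinuousAt.comp (g := X) (hX.1.continuousAt (hopen.mem_nhds fun i => by simp)) ?_
        refine continuousAt_pi.2 fun i => ?_
        split_ifs <;> fun_prop
      have hz1 : ∀ a : ℤ, ContinuousAt (fun z : ℂ => z ^ a) 1 := fun a =>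
        continuousAt_zpow₀ _ _ (Or.inl one_ne_zero)
      exact (hz1 _).mul (((hz1 _).mul (by fun_prop)).mul hXc)
    · filter_upwards [isOpen_ne.mem_nhds (one_ne_zero : (1 : ℂ) ≠ 0)] with z hz
      have h1 : P.eval z = z ^ (3 * n - 1 : ℤ) * g z := by
        rw [hgP z hz, zpow_neg, mul_inv_cancel_left₀ (zpow_ne_zero _ hz)]
      rw [h1, hg]
      ring
  have hode := shiftedEuler_ode hn hsupp hdvd
  have hcast : (((3 * n - 1 : ℤ) : ℤ) : ℂ) = 3 * n - 1 := by push_cast; ring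
  set R := shiftedEuler (3 * n - 1) P
  have hnhds : ∀ z : ℂ, z ≠ 0 → ∀ᶠ w in 𝓝 z, w ≠ 0 := fun z hz => isOpen_ne.mem_nhds hz
  have hg' : ∀ z : ℂ, z ≠ 0 →
      HasDerivAt g (z ^ (-(3 * n - 1 : ℤ) - 1) * R.eval z) z := fun z hz => by
    have h1 := hasDerivAt_zpow_mul_eval P (3 * n - 1) hz
    rw [hcast] at h1
    exact h1.congr_of_eventuallyEq ((hnhds z hz).mono hgP)
  have hθ : ∀ z : ℂ, z ≠ 0 → z * deriv g z = z ^ (-(3 * n - 1 : ℤ)) * R.eval z := fun z hz => by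
    rw [(hg' z hz).deriv, zpow_sub_one₀ hz]
    field_simp
  have hθ' : ∀ z : ℂ, z ≠ 0 → HasDerivAt (fun w => w * deriv g w)
      (z ^ (-(3 * n - 1 : ℤ) - 1) * (shiftedEuler (3 * n - 1) R).eval z) z := fun z hz => by
    have h1 := hasDerivAt_zpow_mul_eval R (3 * n - 1) hz
    rw [hcast] at h1
    exact h1.congr_of_eventuallyEq ((hnhds z hz).mono hθ)
  refine ⟨fun z hz => ⟨(hg' z hz).differentiableAt, ?_⟩, fun z hz hz3 => ?_⟩
  · refine ((hθ' z hz).differentiableAt.div differentiableAt_id hz).congr_of_eventuallyEq ?_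
    filter_upwards [hnhds z hz] with w hw
    exact (mul_div_cancel_left₀ _ hw).symm
  · have h3 : 1 - z ^ 3 ≠ 0 := sub_ne_zero.2 (Ne.symm hz3)
    have h4 := congrArg (eval z) hode
    simp only [eval_add, eval_sub, eval_mul, eval_pow, eval_X, eval_C, eval_one, eval_zero] at h4
    rw [(hθ' z hz).deriv, hθ z hz, hgP z hz, zpow_sub_one₀ hz]
    generalize z ^ (-(3 * n - 1 : ℤ)) = y
    field_simp
    linear_combination y * h4

end
end
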